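/- Let A be an m×n matrix of linear forms over S that is column-graded or row-graded, with m ≤ n. Then the ideal I_2(A) of 2×2 minors of A is radical, and for every term order τ on S the initial ideal in_τ(I_2(A)) is radical. -/

import Mathlib

open MvPolynomial

noncomputable section

namespace CSPaper

/-- The set of variables of the standard `ℤ^v`-graded polynomial ring `S`:
the variable `x_{i j}` of the paper (with `1 ≤ i ≤ v`, `1 ≤ j ≤ n_i`) corresponds to
`⟨i-1, j-1⟩ : MVar v n` where `n (i-1) = n_i - 1`; thus row `i` has `n i + 1 > 0`
variables and the first variable `x_{i 1}` of row `i` corresponds to `⟨i, 0⟩`. -/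
abbrev MVar (v : ℕ) (n : Fin v → ℕ) : Type := Σ i : Fin v, Fin (n i + 1)

/-- The weight function giving the standard `ℤ^v`-grading: `deg (x_{i j}) = e_i ∈ ℤ^v`. -/
def wt (v : ℕ) (n : Fin v → ℕ) : MVar v n → (Fin v → ℕ) := fun p => Pi.single p.1 1

variable {K : Type} [Field K] {v : ℕ} {n : Fin v → ℕ}

/-- An ideal of `S` is `ℤ^v`-graded (multigraded) iff it contains every multihomogeneous
component of each of its elements. -/
def IsMultigraded (I : Ideal (MvPolynomial (MVar v n) K)) : Prop :=
  ∀ f ∈ I, ∀ a : Fin v → ℕ, weightedHomogeneousComponent (wt v n) a f ∈ I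

/-- The value of the `ℤ^v`-graded Hilbert function of the ideal `I` at `a ∈ ℕ^v`:
`dim_K I_a`. -/
def hilb (I : Ideal (MvPolynomial (MVar v n) K)) (a : Fin v → ℕ) : ℕ :=
  Module.finrank K
    ((Submodule.restrictScalars K I ⊓ weightedHomogeneousSubmodule K (wt v n) a :
      Submodule K (MvPolynomial (MVar v n) K)))

/-- Two ideals have the same `ℤ^v`-graded Hilbert series. -/
def sameHS (I J : Ideal (MvPolynomial (MVar v n) K)) : Prop :=
  ∀ a : Fin v → ℕ, hilb I a = hilb J a

/-- The `ℤ^v`-graded `K`-algebra endomorphism of `S` determined by a `v`-tuple of square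
matrices: `x_{i j} ↦ ∑_k (g i)_{k j} x_{i k}`.  For invertible `g i` these are exactly the
elements of `G = GL_{n_1}(K) × ⋯ × GL_{n_v}(K)` acting on `S`. -/
def gAct (g : ∀ i : Fin v, Matrix (Fin (n i + 1)) (Fin (n i + 1)) K) :
    MvPolynomial (MVar v n) K →ₐ[K] MvPolynomial (MVar v n) K :=
  aeval fun p : MVar v n => ∑ k : Fin (n p.1 + 1), C (g p.1 k p.2) * X ⟨p.1, k⟩

/-- A property `P` of `v`-tuples of matrices holds generically (i.e. for a general
`g ∈ GL_{n_1}(K) × ⋯ × GL_{n_v}(K)`) if there is a nonzero polynomial `h` in the matrix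
entries such that `P g` holds for every invertible `g` with `h(g) ≠ 0`. -/
def Generically
    (P : (∀ i : Fin v, Matrix (Fin (n i + 1)) (Fin (n i + 1)) K) → Prop) : Prop :=
  ∃ h : MvPolynomial (Σ i : Fin v, Fin (n i + 1) × Fin (n i + 1)) K, h ≠ 0 ∧
    ∀ g : ∀ i : Fin v, Matrix (Fin (n i + 1)) (Fin (n i + 1)) K,
      (∀ i, IsUnit (g i).det) →
      eval (fun q : Σ i : Fin v, Fin (n i + 1) × Fin (n i + 1) => g q.1 q.2.1 q.2.2) h ≠ 0 →
      P g

/-- The leading exponent (exponent of the leading monomial) of a polynomial with respect to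
a term order `τ` (a `MonomialOrder`); by convention `leadExp τ 0 = 0`. -/
def leadExp (τ : MonomialOrder (MVar v n)) (f : MvPolynomial (MVar v n) K) :
    MVar v n →₀ ℕ :=
  τ.toSyn.symm (f.support.sup τ.toSyn)

/-- The initial ideal `in_τ(I)`: the monomial ideal generated by the leading monomials of the
nonzero elements of `I`. -/
def inIdeal (τ : MonomialOrder (MVar v n)) (I : Ideal (MvPolynomial (MVar v n) K)) :
    Ideal (MvPolynomial (MVar v n) K) :=
  Ideal.span {m | ∃ f ∈ I, f ≠ 0 ∧ m = monomial (leadExp τ f) (1 : K)}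

/-- `G` is a Gröbner basis of `I` with respect to the term order `τ`. -/
def IsGroebnerBasis (τ : MonomialOrder (MVar v n)) (G : Set (MvPolynomial (MVar v n) K))
    (I : Ideal (MvPolynomial (MVar v n) K)) : Prop :=
  G ⊆ (I : Set (MvPolynomial (MVar v n) K)) ∧
    Ideal.span ((fun f => monomial (leadExp τ f) (1 : K)) '' {f ∈ G | f ≠ 0}) = inIdeal τ I

/-- `J = gin_τ(I)`, the `ℤ^v`-graded generic initial ideal: for a general
`g ∈ GL_{n_1}(K) × ⋯ × GL_{n_v}(K)` one has `in_τ(g(I)) = J`. -/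
def IsGin (τ : MonomialOrder (MVar v n)) (I J : Ideal (MvPolynomial (MVar v n) K)) : Prop :=
  Generically fun g => inIdeal τ (Ideal.map (gAct g) I) = J

/-- A term order such that `x_{i j} > x_{i k}` whenever `j < k`. -/
def RespectsVarOrder (τ : MonomialOrder (MVar v n)) : Prop :=
  ∀ (i : Fin v) (j k : Fin (n i + 1)), j < k →
    τ.toSyn (Finsupp.single (⟨i, k⟩ : MVar v n) 1) <
      τ.toSyn (Finsupp.single (⟨i, j⟩ : MVar v n) 1)

/-- An ideal is Borel fixed if it is fixed by every element of the Borel subgroup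
`B = B_{n_1}(K) × ⋯ × B_{n_v}(K)` of upper triangular invertible matrices (upper triangular
with respect to the order `x_{i 1} > x_{i 2} > ⋯` of the variables in each row). -/
def BorelFixed (I : Ideal (MvPolynomial (MVar v n) K)) : Prop :=
  ∀ g : ∀ i : Fin v, Matrix (Fin (n i + 1)) (Fin (n i + 1)) K,
    (∀ i, IsUnit (g i).det) →
    (∀ (i : Fin v) (k j : Fin (n i + 1)), j < k → g i k j = 0) →
    Ideal.map (gAct g) I = I

/-- A Cartwright-Sturmfels ideal: a `ℤ^v`-graded ideal with the same `ℤ^v`-graded Hilbert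
series as some radical Borel fixed ideal. -/
def IsCS (I : Ideal (MvPolynomial (MVar v n) K)) : Prop :=
  IsMultigraded I ∧ ∃ J : Ideal (MvPolynomial (MVar v n) K),
    J.IsRadical ∧ BorelFixed J ∧ sameHS I J

/-- The exponent of the monomial `x_{1 1}^{a 1} ⋯ x_{v 1}^{a v}` of
`T = K[x_{1 1}, …, x_{v 1}] ⊆ S`. -/
def Tmono (v : ℕ) (n : Fin v → ℕ) (a : Fin v → ℕ) : MVar v n →₀ ℕ :=
  ∑ i : Fin v, Finsupp.single (⟨i, 0⟩ : MVar v n) (a i)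

/-- A `ℤ^v`-graded ideal of `S` extended from `T`, i.e. generated by monomials in the
variables `x_{1 1}, …, x_{v 1}`. -/
def ExtendedFromT (J : Ideal (MvPolynomial (MVar v n) K)) : Prop :=
  ∃ A : Set (Fin v → ℕ),
    J = Ideal.span ((fun a => monomial (Tmono v n a) (1 : K)) '' A)

/-- A Cartwright-Sturmfels* ideal: a `ℤ^v`-graded ideal with the same `ℤ^v`-graded Hilbert
series as some ideal extended from `T`. -/
def IsCSstar (J : Ideal (MvPolynomial (MVar v n) K)) : Prop :=
  IsMultigraded J ∧ ∃ C : Ideal (MvPolynomial (MVar v n) K), ExtendedFromT C ∧ sameHS J C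

/-- A monomial ideal. -/
def IsMonomialIdeal (I : Ideal (MvPolynomial (MVar v n) K)) : Prop :=
  ∃ A : Set (MVar v n →₀ ℕ), I = Ideal.span ((fun s => monomial s (1 : K)) '' A)

/-- A squarefree monomial ideal. -/
def IsSqfreeMonomialIdeal (I : Ideal (MvPolynomial (MVar v n) K)) : Prop :=
  ∃ A : Set (MVar v n →₀ ℕ), (∀ s ∈ A, ∀ x, s x ≤ 1) ∧
    I = Ideal.span ((fun s => monomial s (1 : K)) '' A)

/-- `J` is the Alexander dual of the squarefree monomial ideal `I`: `J` is generated by the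
products `∏_{x ∈ P} x` as `P` ranges over the minimal primes of `I`. -/
def IsAlexanderDual (I J : Ideal (MvPolynomial (MVar v n) K)) : Prop :=
  J = Ideal.span {m | ∃ F : Finset (MVar v n),
    Ideal.span ((fun x => (X x : MvPolynomial (MVar v n) K)) '' ↑F) ∈ I.minimalPrimes ∧
    m = ∏ x ∈ F, X x}

/-- The sequence `x_{i j} - λ_{i j} x_{i 1}`, `1 ≤ i ≤ v`, `2 ≤ j ≤ n_i`, as a list. -/
def LamList (lam : MVar v n → K) : List (MvPolynomial (MVar v n) K) :=
  (List.finRange v).flatMap fun i =>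
    ((List.finRange (n i + 1)).drop 1).map fun j =>
      X (⟨i, j⟩ : MVar v n) - C (lam ⟨i, j⟩) * X (⟨i, 0⟩ : MVar v n)

/-- A property of the scalars `λ = (λ_{i j})` holds for general `λ ∈ K^N` if there is a
nonzero polynomial `h` in the `λ_{i j}` such that the property holds whenever `h(λ) ≠ 0`. -/
def GenericallyLam {v : ℕ} {n : Fin v → ℕ} (K : Type) [Field K]
    (P : (MVar v n → K) → Prop) : Prop :=
  ∃ h : MvPolynomial (MVar v n) K, h ≠ 0 ∧
    ∀ lam : MVar v n → K, eval lam h ≠ 0 → P lam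

variable {K : Type} [Field K] {v : ℕ} {n : Fin v → ℕ}

/-- A graded free resolution of an ideal `I` of a polynomial ring graded by an additive
monoid `M` via a weight function `w` on the variables:
`⋯ → F_2 → F_1 → F_0 → I → 0`, where `F_p` is the free module with (finite) basis `ι p`,
the basis element `i : ι p` having degree `deg p i ∈ M`, all maps are graded of degree `0`,
and the complex is exact. -/
structure GradedFreeResolution (σ : Type) (K : Type) [Field K] (M : Type) [AddCommMonoid M]
    (w : σ → M) (I : Ideal (MvPolynomial σ K)) where
  ι : ℕ → Type
  finite : ∀ p, Finite (ι p)
  deg : ∀ p, ι p → M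
  aug : (ι 0 →₀ MvPolynomial σ K) →ₗ[MvPolynomial σ K] MvPolynomial σ K
  d : ∀ p, (ι (p + 1) →₀ MvPolynomial σ K) →ₗ[MvPolynomial σ K] (ι p →₀ MvPolynomial σ K)
  aug_graded : ∀ i : ι 0, (aug (Finsupp.single i 1)).IsWeightedHomogeneous w (deg 0 i)
  d_graded : ∀ (p : ℕ) (i : ι (p + 1)) (j : ι p),
    (d p (Finsupp.single i 1)) j = 0 ∨
      ∃ b, ((d p (Finsupp.single i 1)) j).IsWeightedHomogeneous w b ∧
        b + deg p j = deg (p + 1) i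
  range_aug : LinearMap.range aug = (I : Submodule (MvPolynomial σ K) (MvPolynomial σ K))
  exact_zero : LinearMap.ker aug = LinearMap.range (d 0)
  exact : ∀ p, LinearMap.ker (d p) = LinearMap.range (d (p + 1))

/-- A graded free resolution is minimal if all entries of the matrices of the differentials
between free modules lie in the irrelevant maximal ideal, i.e. have zero constant term. -/
def GradedFreeResolution.Minimal {σ M : Type} [AddCommMonoid M] {w : σ → M}
    {I : Ideal (MvPolynomial σ K)} (F : GradedFreeResolution σ K M w I) : Prop :=
  ∀ (p : ℕ) (i : F.ι (p + 1)) (j : F.ι p),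
    MvPolynomial.constantCoeff ((F.d p (Finsupp.single i 1)) j) = 0

/-- The graded Betti number `β_{p,a}` read off from a (minimal) graded free resolution:
the number of basis elements of `F_p` of degree `a`. -/
def GradedFreeResolution.betti {σ M : Type} [AddCommMonoid M] {w : σ → M}
    {I : Ideal (MvPolynomial σ K)} (F : GradedFreeResolution σ K M w I) (p : ℕ) (a : M) :
    ℕ :=
  Nat.card {i : F.ι p // F.deg p i = a}

/-- The set of `t × t` minors of the matrix `A`. -/
def minorsSet {R : Type} [CommRing R] (t : ℕ) {m N : ℕ} (A : Matrix (Fin m) (Fin N) R) :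
    Set R :=
  {d | ∃ (r : Fin t → Fin m) (c : Fin t → Fin N),
    Function.Injective r ∧ Function.Injective c ∧ d = (A.submatrix r c).det}

/-- `I_t(A)`, the ideal generated by the `t × t` minors of `A`. -/
def minorsIdeal {R : Type} [CommRing R] (t : ℕ) {m N : ℕ}
    (A : Matrix (Fin m) (Fin N) R) : Ideal R :=
  Ideal.span (minorsSet t A)

/-- `A` is column-graded: `N ≤ v` and each entry of the `j`-th column is either `0` or
multihomogeneous of degree `e_j ∈ ℤ^v`. -/
def ColumnGraded {m N : ℕ} (A : Matrix (Fin m) (Fin N) (MvPolynomial (MVar v n) K)) :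
    Prop :=
  ∃ h : N ≤ v, ∀ i j, A i j = 0 ∨
    (A i j).IsWeightedHomogeneous (wt v n) (Pi.single (Fin.castLE h j) 1)

/-- `A` is row-graded: `m ≤ v` and each entry of the `i`-th row is either `0` or
multihomogeneous of degree `e_i ∈ ℤ^v`. -/
def RowGraded {m N : ℕ} (A : Matrix (Fin m) (Fin N) (MvPolynomial (MVar v n) K)) : Prop :=
  ∃ h : m ≤ v, ∀ i j, A i j = 0 ∨
    (A i j).IsWeightedHomogeneous (wt v n) (Pi.single (Fin.castLE h i) 1)

/-- The exponent of the polarization of the monomial `x_{1 1}^{a 1} ⋯ x_{v 1}^{a v}` of `T`: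
the squarefree monomial `∏_i x_{i 1} x_{i 2} ⋯ x_{i (a i)}`. -/
def polExp (v : ℕ) (n : Fin v → ℕ) (a : Fin v → ℕ) : MVar v n →₀ ℕ :=
  ∑ i : Fin v, ∑ j ∈ Finset.univ.filter (fun j : Fin (n i + 1) => (j : ℕ) < a i),
    Finsupp.single (⟨i, j⟩ : MVar v n) 1

/-- `P = pol(C)`, the polarization of an ideal `C` extended from `T`
(the exponents of the generators of `C` must fit inside `S`). -/
def IsPolarizationOfT (C P : Ideal (MvPolynomial (MVar v n) K)) : Prop :=
  ∃ A : Set (Fin v → ℕ), (∀ a ∈ A, ∀ i, a i ≤ n i + 1) ∧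
    C = Ideal.span ((fun a => monomial (Tmono v n a) (1 : K)) '' A) ∧
    P = Ideal.span ((fun a => monomial (polExp v n a) (1 : K)) '' A)

/-- `ψ` is an identification of the quotient of `S` by the `ℤ^v`-graded ideal `Q` with a
standard `ℤ^v`-graded polynomial ring, compatible with the gradings. -/
def IsGradedStructureIso {n₂ : Fin v → ℕ} (Q : Ideal (MvPolynomial (MVar v n) K))
    (ψ : (MvPolynomial (MVar v n) K ⧸ Q) ≃ₐ[K] MvPolynomial (MVar v n₂) K) : Prop :=
  ∀ (f : MvPolynomial (MVar v n) K) (a : Fin v → ℕ),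
    f.IsWeightedHomogeneous (wt v n) a →
      (ψ (Ideal.Quotient.mk Q f)).IsWeightedHomogeneous (wt v n₂) a

end CSPaper

open CSPaper

theorem card_piAntidiag_nat {τ : Type*} [DecidableEq τ] (s : Finset τ) (n : ℕ) :
    (s.piAntidiag n).card = s.card.multichoose n := by
  rw [← Finset.card_finsuppAntidiag_nat_eq_multichoose, Finset.finsuppAntidiag]
  simp

theorem multichoose_succ_comm (p q : ℕ) : (p + 1).multichoose q = (q + 1).multichoose p := by
  rw [Nat.multichoose_eq, Nat.multichoose_eq, show p + 1 + q - 1 = p + q by lia,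
    show q + 1 + p - 1 = p + q by lia, Nat.choose_symm_add]

theorem invOneSubPow_eq_mk_multichoose (p : ℕ) :
    (PowerSeries.invOneSubPow ℤ p).val = PowerSeries.mk fun k => (p.multichoose k : ℤ) := by
  cases p with
  | zero =>
    ext k
    cases k <;> simp [PowerSeries.invOneSubPow_zero, PowerSeries.coeff_one]
  | succ p =>
    rw [PowerSeries.invOneSubPow_val_succ_eq_mk_add_choose]
    ext k
    simpa [Nat.multichoose_eq, show p + 1 + k - 1 = p + k by lia] using Nat.choose_symm_add

theorem sum_antidiagonal_multichoose_mul (p q k : ℕ) :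
    ∑ x ∈ Finset.HasAntidiagonal.antidiagonal k, p.multichoose x.1 * q.multichoose x.2 =
      (p + q).multichoose k := by
  have h := congrArg (fun u : (PowerSeries ℤ)ˣ => PowerSeries.coeff k u.val)
    (PowerSeries.invOneSubPow_add (S := ℤ) (d := p) q)
  simp only [Units.val_mul, invOneSubPow_eq_mk_multichoose, PowerSeries.coeff_mul,
    PowerSeries.coeff_mk] at h
  exact_mod_cast h.symm

theorem sum_piAntidiag_prod_multichoose {τ : Type*} [DecidableEq τ] (s : Finset τ) (a : τ → ℕ)
    (d : ℕ) :
    ∑ q ∈ s.piAntidiag d, ∏ j ∈ s, (a j).multichoose (q j) =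
      (∑ j ∈ s, a j).multichoose d := by
  have hprod : ∏ j ∈ s, (PowerSeries.mk fun k => ((a j).multichoose k : ℤ)) =
      PowerSeries.mk fun k => ((∑ j ∈ s, a j).multichoose k : ℤ) := by
    simp only [← invOneSubPow_eq_mk_multichoose]
    induction s using Finset.induction_on with
    | empty => simp [PowerSeries.invOneSubPow_zero]
    | insert x s hx ih =>
      rw [Finset.prod_insert hx, Finset.sum_insert hx, PowerSeries.invOneSubPow_add, Units.val_mul,
        ih]
  have h := congrArg (PowerSeries.coeff d) hprod
  rw [PowerSeries.coeff_prod] at h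
  simp only [PowerSeries.coeff_mk, Finset.finsuppAntidiag, Finset.sum_map] at h
  rw [← Finset.sum_attach]
  exact_mod_cast h

theorem sum_range_multichoose_eq (D k : ℕ) (h : D ≠ 0 ∨ k ≠ 0) :
    ∑ i ∈ Finset.range D, k.multichoose i = D.multichoose k := by
  cases D with
  | zero =>
    obtain ⟨k, rfl⟩ := Nat.exists_eq_succ_of_ne_zero (h.resolve_left (by simp))
    simp
  | succ D =>
    rw [multichoose_succ_comm]
    induction D with
    | zero => simp
    | succ D ih => rw [Finset.sum_range_succ, ih (by simp), Nat.multichoose_succ_succ, add_comm]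

/-- The number of monomials of degree `a` in `c + r` variables which, for `r ≠ 0`, involve the last
variable. -/
def lastCount (c r a : ℕ) : ℕ :=
  if r = 0 then c.multichoose a else if a = 0 then 0 else (c + r).multichoose (a - 1)

theorem sum_range_lastCount_zero (c a : ℕ) :
    ∑ x ∈ Finset.range (a + 1), c.multichoose (a - x) * (if x = 0 then 1 else 0) =
      lastCount c 0 a := by
  simp [lastCount]

theorem sum_range_lastCount_succ (c q a : ℕ) :
    ∑ x ∈ Finset.range (a + 1),
      c.multichoose (a - x) * (if x = 0 then 0 else x.multichoose q) =
      lastCount c (q + 1) a := by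
  rw [Finset.sum_range_succ']
  cases a with
  | zero => simp [lastCount]
  | succ a =>
    have h := sum_antidiagonal_multichoose_mul (q + 1) c a
    rw [Finset.Nat.sum_antidiagonal_eq_sum_range_succ_mk] at h
    simp only [lastCount, Nat.add_eq_zero_iff, one_ne_zero, and_false, if_false, mul_zero, add_zero,
      if_true, Nat.add_sub_cancel]
    rw [add_comm c, ← h]
    refine Finset.sum_congr rfl fun x _ => ?_
    rw [multichoose_succ_comm x q, Nat.add_sub_add_right, mul_comm]

/-- Triples `(σ, i, q)` where `i < D σ` and `q` is a composition of `i` supported on `σ`. -/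
def stairs {ι : Type*} [Fintype ι] [DecidableEq ι] (D : Finset ι → ℕ) :
    Finset (Σ _ : Finset ι, Σ _ : ℕ, ι → ℕ) :=
  Finset.univ.sigma fun σ => (Finset.range (D σ)).sigma fun i => σ.piAntidiag i

/-- The step attached to a triple in `stairs D`: it is `q + 1` on `σ` and `0` off `σ`. -/
def stairStep {ι : Type*} [DecidableEq ι] (x : Σ _ : Finset ι, Σ _ : ℕ, ι → ℕ) (j : ι) : ℕ :=
  if j ∈ x.1 then x.2.2 j + 1 else 0

theorem stairStep_injOn {ι : Type*} [Fintype ι] [DecidableEq ι] (D : Finset ι → ℕ) :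
    Set.InjOn stairStep (stairs D : Set (Σ _ : Finset ι, Σ _ : ℕ, ι → ℕ)) := by
  rintro ⟨σ, i, q⟩ hx ⟨σ', i', q'⟩ hx' h
  simp only [stairs, Finset.coe_sigma, Set.mem_sigma_iff, Finset.mem_coe, Finset.mem_univ,
    Finset.mem_range, true_and, Finset.mem_piAntidiag] at hx hx'
  have h1 : σ = σ' := by
    ext j
    have := congrFun h j
    simp only [stairStep] at this
    split_ifs at this <;> simp_all
  subst h1
  have h2 : q = q' := by
    ext j
    have := congrFun h j
    simp only [stairStep] at this
    have h3 := hx.2.2 j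
    have h4 := hx'.2.2 j
    split_ifs at this with hj
    · lia
    · have h5 : q j = 0 := by_contra fun h0 => hj (h3 h0)
      have h6 : q' j = 0 := by_contra fun h0 => hj (h4 h0)
      rw [h5, h6]
  subst h2
  have h3 : i = i' := hx.2.1.symm.trans hx'.2.1
  subst h3
  rfl

theorem sum_stairs_prod_lastCount {ι : Type*} [Fintype ι] [DecidableEq ι] (D : Finset ι → ℕ)
    (hD : D ∅ = 1) (c a : ι → ℕ) :
    ∑ x ∈ stairs D, ∏ j, lastCount (c j) (stairStep x j) (a j) =
      ∑ b ∈ Fintype.piFinset fun j => Finset.range (a j + 1),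
        (∏ j, (c j).multichoose (a j - b j)) *
          (D (Finset.univ.filter fun j => b j ≠ 0)).multichoose (∑ j, b j) := by
  have key : ∀ x : Σ _ : Finset ι, Σ _ : ℕ, ι → ℕ,
      ∏ j, lastCount (c j) (stairStep x j) (a j) =
        ∑ b ∈ Fintype.piFinset fun j => Finset.range (a j + 1),
          (∏ j, (c j).multichoose (a j - b j)) *
            if x.1 = Finset.univ.filter (fun j => b j ≠ 0) then
              ∏ j ∈ x.1, (b j).multichoose (x.2.2 j) else 0 := by
    rintro ⟨σ, i, q⟩
    have h1 : ∀ j, lastCount (c j) (stairStep ⟨σ, i, q⟩ j) (a j) =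
        ∑ b ∈ Finset.range (a j + 1), (c j).multichoose (a j - b) *
          if j ∈ σ then (if b = 0 then 0 else b.multichoose (q j)) else (if b = 0 then 1 else 0) := by
      intro j
      by_cases hj : j ∈ σ
      · simp only [stairStep, hj, if_true, sum_range_lastCount_succ]
      · simp only [stairStep, hj, if_false, sum_range_lastCount_zero]
    simp only [h1]
    rw [Finset.prod_univ_sum]
    refine Finset.sum_congr rfl fun b _ => ?_
    rw [Finset.prod_mul_distrib]
    congr 1
    split_ifs with hσ
    · rw [← Finset.prod_subset (Finset.subset_univ σ)]
      · refine Finset.prod_congr rfl fun j hj => ?_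
        have : b j ≠ 0 := by
          rw [hσ] at hj
          simpa using hj
        simp [hj, this]
      · intro j _ hj
        have : b j = 0 := by
          rw [hσ] at hj
          simpa using hj
        simp [hj, this]
    · have : ∃ j, ¬ (j ∈ σ ↔ b j ≠ 0) := by
        by_contra! hc
        exact hσ (by ext j; simp [hc j])
      obtain ⟨j, hj⟩ := this
      refine Finset.prod_eq_zero (Finset.mem_univ j) ?_
      by_cases h : j ∈ σ <;> simp_all
  simp only [key]
  rw [Finset.sum_comm]
  refine Finset.sum_congr rfl fun b _ => ?_
  rw [← Finset.mul_sum]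
  congr 1
  set σ := Finset.univ.filter fun j => b j ≠ 0 with hσ
  rw [stairs, Finset.sum_sigma]
  rw [Finset.sum_eq_single σ]
  · simp only [if_true, Finset.sum_sigma, sum_piAntidiag_prod_multichoose]
    have hb : ∑ j ∈ σ, b j = ∑ j, b j := by
      rw [hσ, Finset.sum_filter_ne_zero]
    rw [hb]
    refine sum_range_multichoose_eq _ _ ?_
    by_cases h : σ = ∅
    · left; simp [h, hD]
    · right
      obtain ⟨j, hj⟩ := Finset.nonempty_iff_ne_empty.mpr h
      rw [← hb]
      have : b j ≠ 0 := by simpa [hσ] using hj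
      have := Finset.single_le_sum (f := b) (fun _ _ => Nat.zero_le _) hj
      lia
  · intro τ _ hτ
    simp [hτ]
  · simp

/-- Dickson: membership in a lower set of exponents only depends on a truncation. -/
theorem exists_forall_min_mem_iff {τ : Type*} [Finite τ] (B : Set (τ → ℕ)) (hB : IsLowerSet B) :
    ∃ N : ℕ, ∀ e : τ → ℕ, (fun i => min (e i) N) ∈ B ↔ e ∈ B := by
  have hfin : {e | Minimal (· ∈ Bᶜ) e}.Finite := by
    exact WellQuasiOrderedLE.finite_of_isAntichain (setOfPred_minimal_antichain _)
  obtain ⟨N, hN⟩ : ∃ N : ℕ, ∀ e, Minimal (· ∈ Bᶜ) e → ∀ i, e i ≤ N := by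
    have h2 : (⋃ e ∈ {e | Minimal (· ∈ Bᶜ) e}, Set.range e).Finite :=
      hfin.biUnion fun e _ => Set.finite_range e
    obtain ⟨N, hN⟩ := h2.bddAbove
    refine ⟨N, fun e he i => hN ?_⟩
    simp only [Set.mem_iUnion]
    exact ⟨e, he, i, rfl⟩
  refine ⟨N, fun e => ⟨fun h => ?_, fun h => hB (fun i => min_le_left _ _) h⟩⟩
  by_contra he
  obtain ⟨g, hg, hmin⟩ := exists_minimal_le_of_wellFoundedLT (· ∈ Bᶜ) e he
  exact hmin.1 (hB (fun i => le_min (hg i) (hN g hmin i)) h)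

theorem prod_sub_le_card_biUnion {κ ι : Type*} [Fintype ι] [DecidableEq ι] (X : Finset κ)
    (r : κ → ι → ℕ) (hr : Set.InjOn r (X : Set κ)) (w : ι → ℕ → ℕ) (hw : ∀ j, Monotone (w j)) :
    ∑ x ∈ X, ∏ j, (if r x j = 0 then w j 0 else w j (r x j) - w j (r x j - 1)) ≤
      (X.biUnion fun x => Fintype.piFinset fun j => Finset.range (w j (r x j))).card := by
  classical
  let box : κ → Finset (ι → ℕ) := fun x => Fintype.piFinset fun j =>
    if r x j = 0 then Finset.range (w j 0) else Finset.Ico (w j (r x j - 1)) (w j (r x j))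
  have h1 : ∀ x, ∏ j, (if r x j = 0 then w j 0 else w j (r x j) - w j (r x j - 1)) =
      (box x).card := by
    intro x
    simp only [box, Fintype.card_piFinset]
    refine Finset.prod_congr rfl fun j _ => ?_
    split_ifs <;> simp
  simp only [h1]
  rw [← Finset.card_biUnion]
  · refine Finset.card_le_card fun f hf => ?_
    simp only [box, Finset.mem_biUnion, Fintype.mem_piFinset] at hf ⊢
    obtain ⟨x, hx, hf⟩ := hf
    refine ⟨x, hx, fun j => ?_⟩
    have := hf j
    split_ifs at this with h0
    · rwa [h0]
    · simp only [Finset.mem_Ico, Finset.mem_range] at this ⊢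
      exact this.2
  · have aux : ∀ x y, ∀ j, r x j < r y j → ∀ f, f ∈ box x → f ∈ box y → False := by
      intro x y j hj f hx hy
      simp only [box, Fintype.mem_piFinset] at hx hy
      have hx := hx j
      have hy := hy j
      rw [if_neg (by lia)] at hy
      have h3 : f j < w j (r x j) := by
        split_ifs at hx with h0
        · rw [h0]; exact Finset.mem_range.mp hx
        · exact (Finset.mem_Ico.mp hx).2
      have h4 := (Finset.mem_Ico.mp hy).1
      have h5 : w j (r x j) ≤ w j (r y j - 1) := hw j (by lia)
      lia
    intro x hx y hy hxy
    rw [Function.onFun, Finset.disjoint_left]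
    intro f hfx hfy
    have : r x ≠ r y := fun h => hxy (hr hx hy h)
    obtain ⟨j, hj⟩ := Function.ne_iff.mp this
    rcases lt_or_gt_of_ne hj with h | h
    · exact aux x y j h f hfx hfy
    · exact aux y x j h f hfy hfx

theorem card_biUnion_product {κ α β : Type*} [DecidableEq α] [DecidableEq β] (X : Finset κ)
    (P : κ → Finset α) (Q : κ → Finset β) :
    (X.biUnion fun x => P x ×ˢ Q x).card =
      ∑ p ∈ X.biUnion P, ((X.filter fun x => p ∈ P x).biUnion Q).card := by
  classical
  rw [← Finset.card_sigma, ← Finset.card_map (Equiv.sigmaEquivProd α β).symm.toEmbedding]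
  congr 1
  ext ⟨p, q⟩
  simp only [Finset.mem_map_equiv, Equiv.symm_symm, Equiv.sigmaEquivProd_apply,
    Finset.mem_biUnion, Finset.mem_product, Finset.mem_sigma, Finset.mem_filter]
  exact ⟨fun ⟨x, hx, hp, hq⟩ => ⟨⟨x, hx, hp⟩, x, ⟨hx, hp⟩, hq⟩,
    fun ⟨_, x, ⟨hx, hp⟩, hq⟩ => ⟨x, hx, hp, hq⟩⟩

theorem card_biUnion_product_range_le {κ α β : Type*} [DecidableEq α] [DecidableEq β]
    (X : Finset κ) (P : κ → Finset α) (Q : κ → Finset β) (w : κ → ℕ)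
    (hw : ∀ x ∈ X, w x ≤ (Q x).card) :
    (X.biUnion fun x => P x ×ˢ Finset.range (w x)).card ≤ (X.biUnion fun x => P x ×ˢ Q x).card := by
  classical
  rw [card_biUnion_product, card_biUnion_product]
  refine Finset.sum_le_sum fun p hp => ?_
  obtain ⟨x0, hx0, hpx⟩ := Finset.mem_biUnion.mp hp
  obtain ⟨x, hx, hmax⟩ := Finset.exists_max_image (X.filter fun x => p ∈ P x) w
    ⟨x0, Finset.mem_filter.mpr ⟨hx0, hpx⟩⟩
  calc _ ≤ (Finset.range (w x)).card := Finset.card_le_card fun i hi => by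
          obtain ⟨y, hy, hi⟩ := Finset.mem_biUnion.mp hi
          exact Finset.mem_range.mpr ((Finset.mem_range.mp hi).trans_le (hmax y hy))
    _ ≤ (Q x).card := by simpa using hw x (Finset.mem_filter.mp hx).1
    _ ≤ _ := Finset.card_le_card fun i hi => Finset.mem_biUnion.mpr ⟨x, hx, hi⟩

theorem card_biUnion_piFinset_eq_product {κ ι : Type*} [Fintype ι] [DecidableEq ι] (X : Finset κ)
    (A : κ → ι → Finset ℕ) (j : ι) :
    (X.biUnion fun x => Fintype.piFinset (A x)).card =
      (X.biUnion fun x => (Fintype.piFinset fun i : {i // i ≠ j} => A x i) ×ˢ A x j).card := by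
  rw [← Finset.card_map
    ((Equiv.funSplitAt j ℕ).trans (Equiv.prodComm _ _)).toEmbedding]
  congr 1
  ext ⟨p, q⟩
  simp only [Finset.mem_map_equiv, Finset.mem_biUnion, Finset.mem_product, Fintype.mem_piFinset]
  refine exists_congr fun x => and_congr_right fun _ => ?_
  constructor
  · intro h
    refine ⟨fun i => ?_, ?_⟩
    · simpa [Equiv.funSplitAt, Equiv.piSplitAt, i.2] using h i
    · simpa [Equiv.funSplitAt, Equiv.piSplitAt] using h j
  · rintro ⟨h1, h2⟩ i
    by_cases hi : i = j
    · subst hi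
      simpa [Equiv.funSplitAt, Equiv.piSplitAt] using h2
    · simpa [Equiv.funSplitAt, Equiv.piSplitAt, hi] using h1 ⟨i, hi⟩

/-- Replacing the sides of a union of boxes by initial segments of `ℕ` does not increase its
size. -/
theorem card_biUnion_piFinset_range_le {κ ι : Type*} [Fintype ι] [DecidableEq ι] (X : Finset κ)
    (A : κ → ι → Finset ℕ) (w : κ → ι → ℕ) (hw : ∀ x ∈ X, ∀ j, w x j ≤ (A x j).card) :
    (X.biUnion fun x => Fintype.piFinset fun j => Finset.range (w x j)).card ≤
      (X.biUnion fun x => Fintype.piFinset (A x)).card := by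
  classical
  suffices h : ∀ s : Finset ι,
      (X.biUnion fun x => Fintype.piFinset fun j =>
        if j ∈ s then Finset.range (w x j) else A x j).card ≤
      (X.biUnion fun x => Fintype.piFinset (A x)).card by
    simpa using h Finset.univ
  intro s
  induction s using Finset.induction_on with
  | empty => simp
  | insert j s hj ih =>
    refine le_trans ?_ ih
    rw [card_biUnion_piFinset_eq_product X _ j, card_biUnion_piFinset_eq_product X _ j]
    have h1 : ∀ x, (Fintype.piFinset fun i : {i // i ≠ j} =>
        if (i : ι) ∈ insert j s then Finset.range (w x i) else A x i) =
        Fintype.piFinset fun i : {i // i ≠ j} =>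
          if (i : ι) ∈ s then Finset.range (w x i) else A x i := by
      intro x
      congr 1
      ext1 i
      simp [i.2]
    simp only [h1, Finset.mem_insert_self, if_true, if_neg hj]
    exact card_biUnion_product_range_le X _ _ _ fun x hx => hw x hx j

/-- Version of `card_biUnion_piFinset_range_le` for boxes with sides in countable types. -/
theorem card_biUnion_piFinset_range_le' {κ ι : Type*} [Fintype ι] [DecidableEq ι] {α : ι → Type*}
    [∀ j, DecidableEq (α j)] [∀ j, Countable (α j)] (X : Finset κ)
    (A : κ → ∀ j, Finset (α j)) (w : κ → ι → ℕ) (hw : ∀ x ∈ X, ∀ j, w x j ≤ (A x j).card) :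
    (X.biUnion fun x => Fintype.piFinset fun j => Finset.range (w x j)).card ≤
      (X.biUnion fun x => Fintype.piFinset (A x)).card := by
  choose g hg using fun j => exists_injective_nat (α j)
  refine (card_biUnion_piFinset_range_le X (fun x j => (A x j).image (g j)) w ?_).trans ?_
  · intro x hx j
    rw [Finset.card_image_of_injective _ (hg j)]
    exact hw x hx j
  · refine (Finset.card_le_card fun f hf => ?_).trans
      (Finset.card_image_le (f := fun (f : ∀ j, α j) j => g j (f j)))
    simp only [Finset.mem_biUnion, Fintype.mem_piFinset, Finset.mem_image] at hf ⊢
    obtain ⟨x, hx, hf⟩ := hf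
    choose f' hf' hff' using hf
    exact ⟨f', ⟨x, hx, hf'⟩, funext hff'⟩

theorem fwdDiff_iter_multichoose (p s β : ℕ) (hs : s ≠ 0) :
    (fwdDiff 1)^[β] (fun k : ℕ => (p.multichoose (k + s) : ℤ)) =
      fun k => ((p - β).multichoose (k + s + β) : ℤ) := by
  induction β with
  | zero => simp
  | succ β ih =>
    rw [Function.iterate_succ_apply', ih]
    ext k
    rw [fwdDiff]
    rcases Nat.eq_zero_or_pos (p - β) with h | h
    · have h1 : p - (β + 1) = 0 := by lia
      obtain ⟨s, rfl⟩ := Nat.exists_eq_succ_of_ne_zero hs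
      rw [h, h1, show k + 1 + (s + 1) + β = (k + 1 + s + β) + 1 by lia,
        show k + (s + 1) + β = (k + s + β) + 1 by lia,
        show k + (s + 1) + (β + 1) = (k + s + β + 1) + 1 by lia]
      simp
    · obtain ⟨d, hd⟩ := Nat.exists_eq_succ_of_ne_zero h.ne'
      rw [hd, show p - (β + 1) = d by lia, show k + 1 + s + β = (k + s + β) + 1 by lia,
        Nat.multichoose_succ_succ, ← add_assoc]
      push_cast
      ring

/-- If two sums of products of shifted multichoose functions agree, then each term of the first sum
is dominated by a term of the second one. -/
theorem exists_le_of_sum_prod_multichoose_eq {κ κ' ι : Type*} [Fintype ι] [DecidableEq ι]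
    (X : Finset κ) (p s : κ → ι → ℕ) (hs : ∀ x ∈ X, ∀ j, s x j ≠ 0)
    (Y : Finset κ') (q t : κ' → ι → ℕ) (ht : ∀ y ∈ Y, ∀ j, t y j ≠ 0)
    (h : ∀ a : ι → ℕ, ∑ x ∈ X, ∏ j, (p x j).multichoose (a j + s x j) =
      ∑ y ∈ Y, ∏ j, (q y j).multichoose (a j + t y j))
    (x : κ) (hx : x ∈ X) (hpx : ∀ j, p x j ≠ 0) :
    ∃ y ∈ Y, ∀ j, p x j ≤ q y j := by
  set β : ι → ℕ := fun j => p x j - 1 with hβ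
  have key : ∀ (p s : ι → ℕ), (∀ j, s j ≠ 0) →
      ∑ k ∈ Fintype.piFinset fun j => Finset.range (β j + 1),
        (∏ j, ((-1 : ℤ) ^ (β j - k j) * (β j).choose (k j))) *
          ∏ j, ((p j).multichoose (k j + s j) : ℤ) =
      ∏ j, ((p j - β j).multichoose (s j + β j) : ℤ) := by
    intro p s hs
    have h1 : ∀ j, ((p j - β j).multichoose (s j + β j) : ℤ) =
        ∑ k ∈ Finset.range (β j + 1), ((-1 : ℤ) ^ (β j - k) * (β j).choose k) *
          ((p j).multichoose (k + s j) : ℤ) := by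
      intro j
      have h2 := congrFun (fwdDiff_iter_multichoose (p j) (s j) (β j) (hs j)) 0
      rw [fwdDiff_iter_eq_sum_shift] at h2
      simpa using h2.symm
    simp only [h1]
    rw [Finset.prod_univ_sum]
    simp only [Finset.prod_mul_distrib]
  have hsum : ∑ x ∈ X, ∏ j, ((p x j - β j).multichoose (s x j + β j) : ℤ) =
      ∑ y ∈ Y, ∏ j, ((q y j - β j).multichoose (t y j + β j) : ℤ) := by
    rw [← Finset.sum_congr rfl fun x hx => key (p x) (s x) (hs x hx),
      ← Finset.sum_congr rfl fun y hy => key (q y) (t y) (ht y hy),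
      Finset.sum_comm, Finset.sum_comm (s := Y)]
    refine Finset.sum_congr rfl fun k _ => ?_
    rw [← Finset.mul_sum, ← Finset.mul_sum]
    congr 1
    exact_mod_cast h k
  have hpos : 0 < ∑ x ∈ X, ∏ j, ((p x j - β j).multichoose (s x j + β j) : ℤ) := by
    refine Finset.sum_pos' (fun x _ => Finset.prod_nonneg fun j _ => by positivity) ⟨x, hx, ?_⟩
    have : ∀ j, p x j - β j = 1 := fun j => by
      have := hpx j
      simp only [hβ]
      lia
    simp [this]
  rw [hsum] at hpos
  obtain ⟨y, hy, hne⟩ := Finset.exists_ne_zero_of_sum_ne_zero hpos.ne'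
  refine ⟨y, hy, fun j => ?_⟩
  by_contra hlt
  refine hne (Finset.prod_eq_zero (Finset.mem_univ j) ?_)
  have h0 : q y j - β j = 0 := by
    simp only [hβ]
    lia
  obtain ⟨d, hd⟩ := Nat.exists_eq_succ_of_ne_zero (ht y hy j)
  rw [h0, hd, show d.succ + β j = (d + β j) + 1 by lia]
  simp

theorem exists_forall_min_mem_iff' {ι : Type*} [Finite ι] {α : ι → Type*} [∀ j, Finite (α j)]
    (B : Set (∀ j, α j → ℕ)) (hB : IsLowerSet B) :
    ∃ N : ℕ, ∀ e : ∀ j, α j → ℕ, (fun j i => min (e j i) N) ∈ B ↔ e ∈ B := by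
  obtain ⟨N, hN⟩ := exists_forall_min_mem_iff (τ := Σ j, α j)
    {e | (fun j i => e ⟨j, i⟩) ∈ B} fun e e' h he => hB (fun j i => h ⟨j, i⟩) he
  exact ⟨N, fun e => hN fun x => e x.1 x.2⟩

theorem multichoose_left_mono (a : ℕ) : Monotone fun p : ℕ => p.multichoose a := by
  refine monotone_nat_of_le_succ fun p => ?_
  cases a with
  | zero => simp
  | succ a => simp [Nat.multichoose_succ_succ]

theorem card_filter_min_eq {α : Type*} [Fintype α] [DecidableEq α] (u : α → ℕ) (N a : ℕ)
    (hu : ∀ i, u i ≤ N) (ha : ∑ i, u i ≤ a) :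
    (((Finset.univ : Finset α).piAntidiag a).filter fun f => (fun i => min (f i) N) = u).card =
      (Finset.univ.filter fun i => u i = N).card.multichoose (a - ∑ i, u i) := by
  rw [← card_piAntidiag_nat, ← Finset.card_image_of_injective
    ((Finset.univ.filter fun i => u i = N).piAntidiag _) (add_right_injective u)]
  congr 1
  ext f
  simp only [Finset.mem_filter, Finset.mem_piAntidiag, Finset.mem_image, Finset.mem_univ,
    implies_true, and_true, true_and]
  constructor
  · rintro ⟨hf, rfl⟩
    have hle : ∀ i, min (f i) N ≤ f i := fun i => min_le_left _ _
    refine ⟨fun i => f i - min (f i) N, ⟨?_, fun i hi => ?_⟩, ?_⟩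
    · have h0 : ∀ i, i ∉ (Finset.univ.filter fun i => min (f i) N = N) →
          f i - min (f i) N = 0 := by
        intro i hi
        simp only [Finset.mem_filter, Finset.mem_univ, true_and] at hi
        lia
      rw [Finset.sum_subset (Finset.subset_univ _) fun i _ hi => h0 i hi]
      rw [← hf, Finset.sum_tsub_distrib _ fun i _ => hle i]
    · lia
    · ext i
      have := hle i
      simp only [Pi.add_apply]
      lia
  · rintro ⟨g, ⟨hg, hgs⟩, rfl⟩
    have h0 : ∀ i, u i ≠ N → g i = 0 := fun i hi => by_contra fun h => hi (hgs i h)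
    constructor
    · have : ∑ i, g i = a - ∑ i, u i := by
        rw [← hg]
        refine (Finset.sum_subset (Finset.subset_univ _) fun i _ hi => h0 i ?_).symm
        simpa using hi
      simp only [Pi.add_apply, Finset.sum_add_distrib, this]
      lia
    · ext i
      have := hu i
      by_cases h : u i = N
      · simp only [Pi.add_apply]
        lia
      · simp only [Pi.add_apply, h0 i h]
        lia

/-- The exponents of multidegree `a`. -/
def expsOfDegree {ι : Type*} [Fintype ι] [DecidableEq ι] {α : ι → Type*} [∀ j, Fintype (α j)]
    [∀ j, DecidableEq (α j)] (a : ι → ℕ) : Finset (∀ j, α j → ℕ) :=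
  Fintype.piFinset fun j => Finset.univ.piAntidiag (a j)

theorem lastCount_add (c r a M : ℕ) (hM : 2 ≤ M) :
    lastCount c r (a + M) = (c + r).multichoose (a + (M - if r = 0 then 0 else 1)) := by
  rw [lastCount]
  split_ifs with h0 h1
  · simp [h0]
  · lia
  · rw [show a + M - 1 = a + (M - 1) by lia]

theorem lastCount_eq_sub (c r a : ℕ) (ha : a ≠ 0) :
    lastCount c r a = if r = 0 then (c + 0).multichoose a else
      (c + r).multichoose a - (c + (r - 1)).multichoose a := by
  rw [lastCount]
  split_ifs with h0
  · simp
  · obtain ⟨a, rfl⟩ := Nat.exists_eq_succ_of_ne_zero ha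
    obtain ⟨r, rfl⟩ := Nat.exists_eq_succ_of_ne_zero h0
    rw [show c + r.succ = (c + r) + 1 by lia, Nat.multichoose_succ_succ]
    simp

/-- A lower set of exponents whose multigraded counting function is a sum of products of
`lastCount`s is, in positive multidegrees, closed under taking multiples. -/
theorem nsmul_mem_of_card_eq_sum_lastCount {κ ι : Type*} [Fintype ι] [DecidableEq ι]
    {α : ι → Type*} [∀ j, Fintype (α j)] [∀ j, DecidableEq (α j)]
    (B : Set (∀ j, α j → ℕ)) [DecidablePred (· ∈ B)] (hB : IsLowerSet B) (c : ι → ℕ)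
    (X : Finset κ) (r : κ → ι → ℕ) (hr : Set.InjOn r (X : Set κ))
    (h : ∀ a : ι → ℕ, (∀ j, a j ≠ 0) → ((expsOfDegree a).filter (· ∈ B)).card =
      ∑ x ∈ X, ∏ j, lastCount (c j) (r x j) (a j))
    (e : ∀ j, α j → ℕ) (he : e ∈ B) (he0 : ∀ j, ∑ i, e j i ≠ 0) (k : ℕ) : k • e ∈ B := by
  classical
  obtain ⟨N, hN⟩ := exists_forall_min_mem_iff' B hB
  let U : Finset (∀ j, α j → ℕ) :=
    (Fintype.piFinset fun j => Fintype.piFinset fun _ => Finset.range (N + 1)).filter (· ∈ B)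
  have hU : ∀ u, u ∈ U ↔ (∀ j i, u j i ≤ N) ∧ u ∈ B := by
    intro u
    simp [U, Fintype.mem_piFinset]
  let F : (∀ j, α j → ℕ) → ∀ j, Finset (α j) := fun u j => Finset.univ.filter fun i => u j i = N
  have hface : ∀ u ∈ U, ∀ f : ∀ j, α j → ℕ, (∀ j i, f j i ≠ 0 → i ∈ F u j) → f ∈ B := by
    intro u hu f hf
    rw [← hN]
    refine hB (fun j i => ?_) ((hU u).mp hu).2
    by_cases h0 : f j i = 0
    · simp [h0]
    · have := hf j i h0
      simp only [F, Finset.mem_filter, Finset.mem_univ, true_and] at this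
      rw [this]
      exact min_le_right _ _
  set M : ℕ := (∑ u ∈ U, ∑ j, ∑ i, u j i) + 2 with hM
  have hMu : ∀ u ∈ U, ∀ j, ∑ i, u j i + 2 ≤ M := by
    intro u hu j
    have h1 : ∑ i, u j i ≤ ∑ j, ∑ i, u j i :=
      Finset.single_le_sum (f := fun j => ∑ i, u j i) (fun _ _ => Nat.zero_le _)
        (Finset.mem_univ j)
    have h2 : ∑ j, ∑ i, u j i ≤ ∑ u ∈ U, ∑ j, ∑ i, u j i :=
      Finset.single_le_sum (f := fun u : ∀ j, α j → ℕ => ∑ j, ∑ i, u j i)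
        (fun _ _ => Nat.zero_le _) hu
    lia
  have hcount : ∀ a : ι → ℕ, ((expsOfDegree fun j => a j + M).filter (· ∈ B)).card =
      ∑ u ∈ U, ∏ j, (F u j).card.multichoose (a j + (M - ∑ i, u j i)) := by
    intro a
    have h1 : ∀ u ∈ U, ∏ j, (F u j).card.multichoose (a j + (M - ∑ i, u j i)) =
        (Fintype.piFinset fun j => ((Finset.univ : Finset (α j)).piAntidiag (a j + M)).filter
          fun f => (fun i => min (f i) N) = u j).card := by
      intro u hu
      rw [Fintype.card_piFinset]
      refine Finset.prod_congr rfl fun j _ => ?_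
      have := hMu u hu j
      rw [card_filter_min_eq _ _ _ (((hU u).mp hu).1 j) (by lia)]
      congr 1
      lia
    rw [Finset.sum_congr rfl h1, ← Finset.card_biUnion]
    · congr 1
      ext f
      simp only [expsOfDegree, Finset.mem_filter, Fintype.mem_piFinset, Finset.mem_biUnion]
      constructor
      · rintro ⟨hf, hfB⟩
        refine ⟨fun j i => min (f j i) N, (hU _).mpr ⟨fun j i => min_le_right _ _, (hN f).mpr hfB⟩,
          fun j => ⟨hf j, rfl⟩⟩
      · rintro ⟨u, hu, hf⟩
        refine ⟨fun j => (hf j).1, ?_⟩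
        rw [← hN]
        have : (fun j i => min (f j i) N) = u := funext fun j => (hf j).2
        rw [this]
        exact ((hU u).mp hu).2
    · intro u _ u' _ huu'
      rw [Function.onFun, Finset.disjoint_left]
      intro f hf hf'
      simp only [Fintype.mem_piFinset, Finset.mem_filter] at hf hf'
      exact huu' (funext fun j => (hf j).2.symm.trans (hf' j).2)
  have hdom : ∀ x ∈ X, (∀ j, c j + r x j ≠ 0) → ∃ u ∈ U, ∀ j, c j + r x j ≤ (F u j).card := by
    intro x hx hx0
    refine exists_le_of_sum_prod_multichoose_eq X (fun x j => c j + r x j)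
      (fun x j => M - if r x j = 0 then 0 else 1) ?_ U (fun u j => (F u j).card)
      (fun u j => M - ∑ i, u j i) ?_ ?_ x hx hx0
    · intro x _ j
      split_ifs <;> lia
    · intro u hu j
      have := hMu u hu j
      lia
    · intro a
      rw [← hcount, h _ fun j => by lia]
      refine Finset.sum_congr rfl fun x _ => Finset.prod_congr rfl fun j _ => ?_
      rw [lastCount_add _ _ _ _ (by lia)]
  let X' := X.filter fun x => ∀ j, c j + r x j ≠ 0
  have hdom' : ∀ x, ∃ u, x ∈ X' → u ∈ U ∧ ∀ j, c j + r x j ≤ (F u j).card := by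
    intro x
    by_cases hx : x ∈ X'
    · obtain ⟨u, hu⟩ := hdom x (Finset.mem_filter.mp hx).1 (Finset.mem_filter.mp hx).2
      exact ⟨u, fun _ => hu⟩
    · exact ⟨0, fun h => absurd h hx⟩
  choose u hu using hdom'
  let a : ι → ℕ := fun j => ∑ i, e j i
  let V := X'.biUnion fun x => Fintype.piFinset fun j => (F (u x) j).piAntidiag (a j)
  have hV : V ⊆ (expsOfDegree a).filter (· ∈ B) := by
    intro f hf
    obtain ⟨x, hx, hf⟩ := Finset.mem_biUnion.mp hf
    rw [Fintype.mem_piFinset] at hf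
    simp only [Finset.mem_piAntidiag] at hf
    rw [Finset.mem_filter, expsOfDegree, Fintype.mem_piFinset]
    refine ⟨fun j => ?_, hface _ (hu x hx).1 f fun j => (hf j).2⟩
    rw [Finset.mem_piAntidiag]
    refine ⟨?_, fun i _ => Finset.mem_univ i⟩
    rw [← (hf j).1]
    exact (Finset.sum_subset (Finset.subset_univ _) fun i _ hi =>
      by_contra fun h => hi ((hf j).2 i h)).symm
  have hle : ((expsOfDegree a).filter (· ∈ B)).card ≤ V.card := by
    rw [h a he0, ← Finset.sum_subset (Finset.filter_subset _ X : X' ⊆ X)]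
    · calc _ = ∑ x ∈ X', ∏ j, (if r x j = 0 then (c j + 0).multichoose (a j) else
              (c j + r x j).multichoose (a j) - (c j + (r x j - 1)).multichoose (a j)) :=
            Finset.sum_congr rfl fun x _ => Finset.prod_congr rfl fun j _ =>
              lastCount_eq_sub _ _ _ (he0 j)
        _ ≤ _ := prod_sub_le_card_biUnion X' r (hr.mono (Finset.filter_subset _ X))
              (fun j q => (c j + q).multichoose (a j))
              fun j q q' hq => multichoose_left_mono (a j) (Nat.add_le_add_left hq _)
        _ ≤ V.card := card_biUnion_piFinset_range_le' X' _ _ fun x hx j => by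
              rw [card_piAntidiag_nat]
              exact multichoose_left_mono _ ((hu x hx).2 j)
    · intro x hx hx'
      have : ∃ j, c j + r x j = 0 := by
        by_contra! hc
        exact hx' (Finset.mem_filter.mpr ⟨hx, hc⟩)
      obtain ⟨j, hj⟩ := this
      refine Finset.prod_eq_zero (Finset.mem_univ j) ?_
      obtain ⟨d, hd⟩ := Nat.exists_eq_succ_of_ne_zero (he0 j)
      have h1 : c j = 0 := by lia
      have h2 : r x j = 0 := by lia
      simp only [a, hd, h1, h2, lastCount, if_true, Nat.multichoose_zero_succ]
  have hVe : e ∈ V := by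
    rw [Finset.eq_of_subset_of_card_le hV hle, Finset.mem_filter, expsOfDegree,
      Fintype.mem_piFinset]
    refine ⟨fun j => ?_, he⟩
    simp [a]
  obtain ⟨x, hx, hxe⟩ := Finset.mem_biUnion.mp hVe
  rw [Fintype.mem_piFinset] at hxe
  refine hface _ (hu x hx).1 _ fun j i hi => ?_
  refine (Finset.mem_piAntidiag.mp (hxe j)).2 i fun h0 => hi ?_
  simp [h0]

/-- A lower set of exponents with the multigraded counting function of the ideal of `2`-minors of a
column-graded matrix is closed under taking multiples. -/
theorem nsmul_mem_of_card_eq {ι : Type*} [Fintype ι] [DecidableEq ι]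
    {α : ι → Type*} [∀ j, Fintype (α j)] [∀ j, DecidableEq (α j)]
    (B : Set (∀ j, α j → ℕ)) [DecidablePred (· ∈ B)] (hB : IsLowerSet B) (c : ι → ℕ)
    (D : Finset ι → ℕ) (hD : D ∅ = 1)
    (h : ∀ a : ι → ℕ, ((expsOfDegree a).filter (· ∈ B)).card =
      ∑ b ∈ Fintype.piFinset fun j => Finset.range (a j + 1),
        (∏ j, (c j).multichoose (a j - b j)) *
          (D (Finset.univ.filter fun j => b j ≠ 0)).multichoose (∑ j, b j))
    (e : ∀ j, α j → ℕ) (he : e ∈ B) (k : ℕ) : k • e ∈ B := by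
  classical
  let p : ι → Prop := fun j => ∑ i, e j i ≠ 0
  let ext0 : (∀ j : {j // p j}, α j → ℕ) → ∀ j, α j → ℕ :=
    fun f j => if hj : p j then f ⟨j, hj⟩ else 0
  have hext_pos : ∀ f (j : {j // p j}), ext0 f j = f j := fun f j => by
    simp only [ext0, dif_pos j.2]
  have he_ext : ext0 (fun j => e j) = e := by
    ext j i
    by_cases hj : p j
    · simp only [ext0, dif_pos hj]
    · simp only [ext0, dif_neg hj]
      have h0 : ∑ i, e j i = 0 := not_not.mp hj
      exact ((Finset.sum_eq_zero_iff.mp h0) i (Finset.mem_univ i)).symm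
  have hext_inj : Function.Injective ext0 := fun f g hfg => by
    ext j : 1
    rw [← hext_pos f, ← hext_pos g, hfg]
  let B' : Set (∀ j : {j // p j}, α j → ℕ) := ext0 ⁻¹' B
  have hB' : IsLowerSet B' := fun f g hgf hf => hB (fun j => by
    by_cases hj : p j
    · simp only [ext0, dif_pos hj]
      exact hgf ⟨j, hj⟩
    · simp only [ext0, dif_neg hj]
      exact le_rfl) hf
  let X := (stairs D).filter fun x => ∀ j, ¬ p j → stairStep x j = 0
  have hX : Set.InjOn (fun (x : Σ _ : Finset ι, Σ _ : ℕ, ι → ℕ) (j : {j // p j}) => stairStep x (j : ι))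
      (X : Set (Σ _ : Finset ι, Σ _ : ℕ, ι → ℕ)) := by
    intro x hx y hy hxy
    have hx := Finset.mem_filter.mp hx
    have hy := Finset.mem_filter.mp hy
    refine stairStep_injOn D hx.1 hy.1 (funext fun j => ?_)
    by_cases hj : p j
    · exact congrFun hxy ⟨j, hj⟩
    · rw [hx.2 j hj, hy.2 j hj]
  have key := nsmul_mem_of_card_eq_sum_lastCount B' hB' (fun j => c j) X _ hX ?_ (fun j => e j)
    (by rw [Set.mem_preimage, he_ext]; exact he) (fun j => j.2) k
  · have h2 : ext0 (k • fun j : {j // p j} => e j) = k • ext0 fun j => e j := by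
      ext j i
      by_cases hj : p j <;> simp [ext0, hj]
    have h3 : ext0 (k • fun j : {j // p j} => e j) ∈ B := key
    rwa [h2, he_ext] at h3
  · intro a _
    let a' : ι → ℕ := fun j => if hj : p j then a ⟨j, hj⟩ else 0
    have h1 : ((expsOfDegree a).filter (· ∈ B')).card =
        ((expsOfDegree a').filter (· ∈ B)).card := by
      rw [← Finset.card_image_of_injective _ hext_inj]
      congr 1
      ext f
      simp only [Finset.mem_image, Finset.mem_filter, expsOfDegree, Fintype.mem_piFinset,
        Finset.mem_piAntidiag, Finset.mem_univ, implies_true, and_true]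
      constructor
      · rintro ⟨f, ⟨hf, hfB⟩, rfl⟩
        refine ⟨fun j => ?_, hfB⟩
        by_cases hj : p j
        · simpa [ext0, a', hj] using hf ⟨j, hj⟩
        · simp [ext0, a', hj]
      · rintro ⟨hf, hfB⟩
        have hff : ext0 (fun j => f j) = f := by
          ext j i
          by_cases hj : p j
          · simp only [ext0, dif_pos hj]
          · simp only [ext0, dif_neg hj]
            have h0 := hf j
            simp only [a', dif_neg hj] at h0
            exact ((Finset.sum_eq_zero_iff.mp h0) i (Finset.mem_univ i)).symm
        refine ⟨fun j => f j, ⟨fun j => ?_, ?_⟩, hff⟩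
        · rw [hf j]
          simp [a', j.2]
        · rw [Set.mem_preimage, hff]
          exact hfB
    rw [h1, h, ← sum_stairs_prod_lastCount D hD,
      ← Finset.sum_subset (Finset.filter_subset _ _ : X ⊆ stairs D)]
    · refine Finset.sum_congr rfl fun x hx => ?_
      have hx := (Finset.mem_filter.mp hx).2
      have hsub : ∏ j : {j // p j}, lastCount (c j) (stairStep x j) (a j) =
          ∏ j : {j // p j}, lastCount (c j) (stairStep x j) (a' j) := by
        refine Finset.prod_congr rfl fun j _ => ?_
        simp [a', j.2]
      rw [hsub, ← Finset.prod_subtype (Finset.univ.filter p) (by simp)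
        fun j => lastCount (c j) (stairStep x j) (a' j)]
      refine (Finset.prod_subset (Finset.filter_subset _ _) fun j _ hj => ?_).symm
      have hj : ¬ p j := by simpa using hj
      simp [a', hj, hx j hj, lastCount]
    · intro x hx hx'
      have : ∃ j, ¬ p j ∧ stairStep x j ≠ 0 := by
        by_contra! hc
        exact hx' (Finset.mem_filter.mpr ⟨hx, hc⟩)
      obtain ⟨j, hj, hj'⟩ := this
      refine Finset.prod_eq_zero (Finset.mem_univ j) ?_
      simp [a', hj, hj', lastCount]

/-- The exponents of the leading monomials of the nonzero elements of `I`. -/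
def leadExps {σ K : Type*} [Field K] (τ : MonomialOrder σ) (I : Ideal (MvPolynomial σ K)) :
    Set (σ →₀ ℕ) :=
  {d | ∃ f ∈ I, f ≠ 0 ∧ τ.degree f = d}

section LeadExps

variable {σ K : Type*} [Field K] (τ : MonomialOrder σ) (I : Ideal (MvPolynomial σ K))

theorem isUpperSet_leadExps : IsUpperSet (leadExps τ I) := by
  rintro d d' hdd' ⟨f, hf, hf0, rfl⟩
  have hm : monomial (d' - τ.degree f) (1 : K) ≠ 0 := by simp
  refine ⟨monomial (d' - τ.degree f) 1 * f, I.mul_mem_left _ hf, mul_ne_zero hm hf0, ?_⟩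
  classical
  rw [τ.degree_mul hm hf0, τ.degree_monomial, if_neg one_ne_zero, tsub_add_cancel_of_le hdd']

theorem eq_zero_of_mem_of_support {f : MvPolynomial σ K} (hf : f ∈ I)
    (h : ∀ d ∈ f.support, d ∉ leadExps τ I) : f = 0 := by
  by_contra hf0
  exact h _ (τ.degree_mem_support hf0) ⟨f, hf, hf0, rfl⟩

theorem sup_restrictSupport_compl_leadExps :
    I.restrictScalars K ⊔ restrictSupport K (leadExps τ I)ᶜ = ⊤ := by
  classical
  set N := I.restrictScalars K ⊔ restrictSupport K (leadExps τ I)ᶜ with hN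
  have hmon : ∀ s : τ.syn, ∀ c : K, monomial (τ.toSyn.symm s) c ∈ N := by
    intro s
    induction s using WellFoundedLT.induction with
    | ind s ih =>
      intro c
      by_cases hs : τ.toSyn.symm s ∈ leadExps τ I
      · obtain ⟨f, hf, hf0, hfs⟩ := hs
        have hlc : τ.leadingCoeff f ≠ 0 := τ.leadingCoeff_ne_zero_iff.mpr hf0
        have hu : C (c * (τ.leadingCoeff f)⁻¹) * f ∈ N :=
          Submodule.mem_sup_left (I.mul_mem_left _ hf)
        have hrest : C (c * (τ.leadingCoeff f)⁻¹) * f - monomial (τ.toSyn.symm s) c ∈ N := by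
          rw [MvPolynomial.as_sum (C (c * (τ.leadingCoeff f)⁻¹) * f - monomial (τ.toSyn.symm s) c)]
          refine Submodule.sum_mem _ fun d hd => ?_
          have hds : d ≠ τ.toSyn.symm s := by
            rintro rfl
            rw [mem_support_iff, coeff_sub, coeff_C_mul, coeff_monomial, if_pos rfl, ← hfs] at hd
            refine hd ?_
            rw [← MonomialOrder.leadingCoeff, mul_assoc, inv_mul_cancel₀ hlc, mul_one, sub_self]
          have hdf : d ∈ f.support := by
            rw [mem_support_iff, coeff_sub, coeff_C_mul, coeff_monomial, if_neg hds.symm,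
              sub_zero] at hd
            exact mem_support_iff.mpr (right_ne_zero_of_mul hd)
          have hlt : τ.toSyn d < s := by
            refine lt_of_le_of_ne ?_ fun h => hds (by rw [← h]; simp)
            have := τ.le_degree hdf
            rwa [hfs, τ.toSyn.apply_symm_apply] at this
          have h1 := ih _ hlt
          rw [τ.toSyn.symm_apply_apply] at h1
          exact h1 _
        have := N.sub_mem hu hrest
        rwa [sub_sub_cancel] at this
      · refine Submodule.mem_sup_right ?_
        rw [mem_restrictSupport_iff]
        intro d hd
        have := support_monomial_subset hd
        rw [Finset.mem_singleton] at this
        rw [this]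
        exact hs
  rw [eq_top_iff]
  rintro f -
  rw [MvPolynomial.as_sum f]
  refine Submodule.sum_mem _ fun d _ => ?_
  simpa using hmon (τ.toSyn d) (coeff d f)

theorem exists_sub_mem_support (f : MvPolynomial σ K) :
    ∃ g, f - g ∈ I ∧ ∀ d ∈ g.support, d ∉ leadExps τ I := by
  have hf : f ∈ I.restrictScalars K ⊔ restrictSupport K (leadExps τ I)ᶜ := by
    rw [sup_restrictSupport_compl_leadExps]
    trivial
  obtain ⟨h, hh, g, hg, rfl⟩ := Submodule.mem_sup.mp hf
  refine ⟨g, by simpa using hh, fun d hd => ?_⟩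
  rw [mem_restrictSupport_iff] at hg
  exact hg hd

theorem pow_sub_pow_mem {R : Type*} [CommRing R] {I : Ideal R} {f g : R} (h : f - g ∈ I) (k : ℕ) :
    f ^ k - g ^ k ∈ I :=
  I.mem_of_dvd (sub_dvd_pow_sub_pow f g k) h

theorem isRadical_of_nsmul_notMem
    (h : ∀ d, d ∉ leadExps τ I → ∀ k : ℕ, k • d ∉ leadExps τ I) : I.IsRadical := by
  rintro f ⟨k, hk⟩
  obtain ⟨g, hfg, hg⟩ := exists_sub_mem_support τ I f
  have hgk : g ^ k ∈ I := by
    have := I.sub_mem hk (pow_sub_pow_mem hfg k)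
    rwa [sub_sub_cancel] at this
  have hg0 : g = 0 := by
    by_contra hg0
    exact h _ (hg _ (τ.degree_mem_support hg0)) k ⟨g ^ k, hgk, pow_ne_zero k hg0, τ.degree_pow g k⟩
  rwa [hg0, sub_zero] at hfg

theorem isRadical_span_leadExps_of_nsmul_notMem
    (h : ∀ d, d ∉ leadExps τ I → ∀ k : ℕ, k • d ∉ leadExps τ I) :
    (Ideal.span ((fun d => monomial d (1 : K)) '' leadExps τ I)).IsRadical := by
  classical
  rintro f ⟨k, hk⟩
  set J := Ideal.span ((fun d => monomial d (1 : K)) '' leadExps τ I) with hJ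
  set g := ∑ d ∈ f.support.filter (· ∉ leadExps τ I), monomial d (coeff d f) with hg
  have hgs : ∀ d ∈ g.support, d ∉ leadExps τ I := by
    intro d hd
    by_contra hdE
    rw [mem_support_iff, hg, coeff_sum] at hd
    refine hd (Finset.sum_eq_zero fun e he => ?_)
    rw [coeff_monomial, if_neg]
    rintro rfl
    exact (Finset.mem_filter.mp he).2 hdE
  have hfg : f - g ∈ J := by
    have h1 : f = ∑ d ∈ f.support, monomial d (coeff d f) := MvPolynomial.as_sum f
    have h2 : f - g = ∑ d ∈ f.support.filter (· ∈ leadExps τ I), monomial d (coeff d f) := by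
      rw [sub_eq_iff_eq_add, hg, Finset.sum_filter_add_sum_filter_not, ← h1]
    rw [h2]
    refine J.sum_mem fun d hd => ?_
    have h3 : monomial d (coeff d f) = C (coeff d f) * monomial d (1 : K) := by
      rw [C_mul_monomial, mul_one]
    rw [h3]
    exact J.mul_mem_left _ (Ideal.subset_span ⟨d, (Finset.mem_filter.mp hd).2, rfl⟩)
  have hgk : g ^ k ∈ J := by
    have := J.sub_mem hk (pow_sub_pow_mem hfg k)
    rwa [sub_sub_cancel] at this
  have hg0 : g = 0 := by
    by_contra hg0
    have h4 := τ.degree_mem_support (pow_ne_zero k hg0)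
    rw [τ.degree_pow] at h4
    obtain ⟨e, he, hle⟩ := mem_ideal_span_monomial_image.mp hgk _ h4
    exact h _ (hgs _ (τ.degree_mem_support hg0)) k (isUpperSet_leadExps τ I hle he)
  rwa [hg0, sub_zero] at hfg

end LeadExps

section Count

variable {σ K M : Type*} [Field K] [AddCommMonoid M] [DecidableEq M]

theorem mk_mem_span_monomials (w : σ → M) (τ : MonomialOrder σ) (I : Ideal (MvPolynomial σ K))
    (hI : ∀ f ∈ I, ∀ a, weightedHomogeneousComponent w a f ∈ I) (a : M)
    {f : MvPolynomial σ K} (hf : f.IsWeightedHomogeneous w a) :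
    Ideal.Quotient.mkₐ K I f ∈ Submodule.span K
      ((fun d => Ideal.Quotient.mkₐ K I (monomial d 1)) ''
        {d | Finsupp.weight w d = a ∧ d ∉ leadExps τ I}) := by
  obtain ⟨g, hfg, hg⟩ := exists_sub_mem_support τ I f
  have h1 : f - weightedHomogeneousComponent w a g ∈ I := by
    have h2 := hI _ hfg a
    rwa [map_sub, weightedHomogeneousComponent_of_mem hf, if_pos rfl] at h2
  have h3 : Ideal.Quotient.mkₐ K I f =
      Ideal.Quotient.mkₐ K I (weightedHomogeneousComponent w a g) :=
    Ideal.Quotient.eq.mpr h1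
  rw [h3, MvPolynomial.as_sum (weightedHomogeneousComponent w a g), map_sum]
  refine Submodule.sum_mem _ fun d hd => ?_
  rw [mem_support_iff, coeff_weightedHomogeneousComponent] at hd
  have hd1 : Finsupp.weight w d = a := by
    by_contra hne
    exact hd (if_neg hne)
  rw [if_pos hd1] at hd
  have h4 : monomial d (coeff d (weightedHomogeneousComponent w a g)) =
      coeff d (weightedHomogeneousComponent w a g) • monomial d (1 : K) := by
    rw [smul_monomial, smul_eq_mul, mul_one]
  rw [h4, map_smul]
  exact Submodule.smul_mem _ _
    (Submodule.subset_span ⟨d, ⟨hd1, hg d (mem_support_iff.mpr hd)⟩, rfl⟩)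

theorem linearIndependent_mk_monomial (τ : MonomialOrder σ) (I : Ideal (MvPolynomial σ K)) :
    LinearIndependent K fun d : {d // d ∉ leadExps τ I} =>
      Ideal.Quotient.mkₐ K I (monomial d.1 1) := by
  rw [linearIndependent_iff']
  intro s c hs
  set f : MvPolynomial σ K := ∑ d ∈ s, c d • monomial d.1 (1 : K) with hf
  have hcoeff : ∀ d : {d // d ∉ leadExps τ I}, d ∈ s → coeff d.1 f = c d := by
    classical
    intro d hd
    rw [hf, coeff_sum, Finset.sum_eq_single d]
    · simp
    · intro e _ hne
      rw [coeff_smul, coeff_monomial, if_neg fun h => hne (Subtype.ext h), smul_zero]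
    · exact fun h => absurd hd h
  have hfI : f ∈ I := by
    rw [← Ideal.Quotient.eq_zero_iff_mem]
    have : Ideal.Quotient.mkₐ K I f = 0 := by
      rw [hf, map_sum, ← hs]
      simp only [map_smul]
    exact this
  have hf0 : f = 0 := by
    refine eq_zero_of_mem_of_support τ I hfI fun d hd => ?_
    classical
    rw [mem_support_iff, hf, coeff_sum] at hd
    obtain ⟨e, _, he⟩ := Finset.exists_ne_zero_of_sum_ne_zero hd
    rw [coeff_smul, coeff_monomial] at he
    have h1 : e.1 = d := by
      by_contra h1
      exact he (by rw [if_neg h1, smul_zero])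
    exact h1 ▸ e.2
  intro d hd
  rw [← hcoeff d hd, hf0, coeff_zero]

/-- If a family of homogeneous elements of degree `a` has a dual family of linear functionals
vanishing on `I` and spans modulo `I`, then its size is the number of standard monomials of
degree `a`. -/
theorem card_eq_of_dual_of_span {κ : Type*} (w : σ → M) (τ : MonomialOrder σ)
    (I : Ideal (MvPolynomial σ K))
    (hI : ∀ f ∈ I, ∀ a, weightedHomogeneousComponent w a f ∈ I) (a : M)
    (Bd : Finset (σ →₀ ℕ)) (hBd : ∀ d, d ∈ Bd ↔ Finsupp.weight w d = a ∧ d ∉ leadExps τ I)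
    (X : Finset κ) (b : κ → MvPolynomial σ K) (φ : κ → MvPolynomial σ K →ₗ[K] K)
    (hb : ∀ x ∈ X, (b x).IsWeightedHomogeneous w a) (hφ : ∀ x ∈ X, ∀ f ∈ I, φ x f = 0)
    (hφ1 : ∀ x ∈ X, φ x (b x) = 1) (hφ0 : ∀ x ∈ X, ∀ y ∈ X, x ≠ y → φ x (b y) = 0)
    (hspan : ∀ d, Finsupp.weight w d = a → Ideal.Quotient.mkₐ K I (monomial d 1) ∈
      Submodule.span K ((fun x => Ideal.Quotient.mkₐ K I (b x)) '' (X : Set κ))) :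
    Bd.card = X.card := by
  have hindX : LinearIndependent K fun x : X => Ideal.Quotient.mkₐ K I (b x) := by
    rw [linearIndependent_iff']
    intro s c hs x hx
    have hsum : ∑ y ∈ s, c y • b y ∈ I := by
      rw [← Ideal.Quotient.eq_zero_iff_mem]
      have : Ideal.Quotient.mkₐ K I (∑ y ∈ s, c y • b y) = 0 := by
        rw [map_sum, ← hs]
        simp only [map_smul]
      exact this
    have h1 := hφ x x.2 _ hsum
    rw [map_sum, Finset.sum_eq_single x] at h1
    · rwa [map_smul, hφ1 x x.2, smul_eq_mul, mul_one] at h1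
    · intro y _ hne
      rw [map_smul, hφ0 x x.2 y y.2 fun h => hne (Subtype.ext h).symm, smul_zero]
    · exact fun h => absurd hx h
  have hindB : LinearIndependent K fun d : Bd => Ideal.Quotient.mkₐ K I (monomial d.1 1) :=
    (linearIndependent_mk_monomial τ I).comp
      (fun d : Bd => ⟨d.1, ((hBd d.1).mp d.2).2⟩) fun d e h =>
        Subtype.ext (congrArg (fun x : {d // d ∉ leadExps τ I} => x.1) h)
  have h1 := finrank_span_eq_card hindX
  have h2 := finrank_span_eq_card hindB
  rw [Fintype.card_coe] at h1 h2
  rw [← h1, ← h2]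
  have h3 : Submodule.span K (Set.range fun d : Bd => Ideal.Quotient.mkₐ K I (monomial d.1 1)) =
      Submodule.span K (Set.range fun x : X => Ideal.Quotient.mkₐ K I (b x)) := by
    refine le_antisymm (Submodule.span_le.mpr ?_) (Submodule.span_le.mpr ?_)
    · rintro _ ⟨d, rfl⟩
      have := hspan d.1 ((hBd d.1).mp d.2).1
      rw [Set.image_eq_range] at this
      exact this
    · rintro _ ⟨x, rfl⟩
      have := mk_mem_span_monomials w τ I hI a (hb x x.2)
      rw [Set.image_eq_range] at this
      refine Submodule.span_mono ?_ this
      rintro _ ⟨⟨d, hd⟩, rfl⟩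
      exact ⟨⟨d, (hBd d).mpr hd⟩, rfl⟩
  rw [h3]

end Count

theorem exists_multiset_prod_map_fst_snd {α β : Type*} (J : Multiset α) (L : Multiset β)
    (h : J.card = L.card) :
    ∃ t : Multiset (α × β), t.map Prod.fst = J ∧ t.map Prod.snd = L := by
  induction J using Quotient.inductionOn with
  | _ J =>
    induction L using Quotient.inductionOn with
    | _ L =>
      have h' : J.length = L.length := h
      refine ⟨(J.zip L : List (α × β)), ?_, ?_⟩
      · simp [Multiset.map_coe, List.map_fst_zip h'.le]
      · simp [Multiset.map_coe, List.map_snd_zip h'.ge]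

section PairProd

variable {K ι U R : Type*} [Field K] [AddCommGroup U] [Module K U] [CommRing R] [Algebra K R]

/-- The product of the elements `p j u` over a multiset of pairs `(j, u)`. -/
def pairProd (p : ι → U →ₗ[K] R) (t : Multiset (ι × U)) : R :=
  (t.map fun x => p x.1 x.2).prod

theorem pairProd_cons (p : ι → U →ₗ[K] R) (x : ι × U) (t : Multiset (ι × U)) :
    pairProd p (x ::ₘ t) = p x.1 x.2 * pairProd p t := by
  simp [pairProd]

theorem pairProd_add (p : ι → U →ₗ[K] R) (t t' : Multiset (ι × U)) :
    pairProd p (t + t') = pairProd p t * pairProd p t' := by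
  simp [pairProd]

variable (p : ι → U →ₗ[K] R) (hp : ∀ j j' u u', p j u * p j' u' = p j' u * p j u')

include hp

theorem exists_pairProd_eq_mul (t : Multiset (ι × U)) (j : ι) (u : U) (hj : j ∈ t.map Prod.fst)
    (hu : u ∈ t.map Prod.snd) :
    ∃ t' : Multiset (ι × U), j ::ₘ t'.map Prod.fst = t.map Prod.fst ∧
      u ::ₘ t'.map Prod.snd = t.map Prod.snd ∧ pairProd p t = p j u * pairProd p t' := by
  obtain ⟨⟨j, u'⟩, hx, rfl⟩ := Multiset.mem_map.mp hj
  obtain ⟨t1, rfl⟩ := Multiset.exists_cons_of_mem hx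
  rw [Multiset.map_cons, Multiset.mem_cons] at hu
  rcases hu with rfl | hu
  · exact ⟨t1, by simp, by simp, pairProd_cons _ _ _⟩
  · obtain ⟨⟨j', u⟩, hy, rfl⟩ := Multiset.mem_map.mp hu
    obtain ⟨t2, rfl⟩ := Multiset.exists_cons_of_mem hy
    refine ⟨(j', u') ::ₘ t2, by simp, by simpa using Multiset.cons_swap _ _ _, ?_⟩
    rw [pairProd_cons, pairProd_cons, pairProd_cons, ← mul_assoc, ← mul_assoc]
    congr 1
    rw [hp, mul_comm]

theorem pairProd_eq_of_map_eq (t t' : Multiset (ι × U)) (h1 : t.map Prod.fst = t'.map Prod.fst)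
    (h2 : t.map Prod.snd = t'.map Prod.snd) : pairProd p t = pairProd p t' := by
  induction t using Multiset.induction_on generalizing t' with
  | empty =>
    have : t' = 0 := by simpa [eq_comm] using h1
    rw [this]
  | cons x t ih =>
    obtain ⟨t1, ht1, ht2, ht3⟩ := exists_pairProd_eq_mul p hp t' x.1 x.2 (by simp [← h1])
      (by simp [← h2])
    rw [ht3, pairProd_cons, ih t1]
    · rw [← ht1, Multiset.map_cons] at h1
      exact (Multiset.cons_inj_right _).mp h1
    · rw [← ht2, Multiset.map_cons] at h2
      exact (Multiset.cons_inj_right _).mp h2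

theorem pairProd_eq_zero (t : Multiset (ι × U)) (j : ι) (u : U) (hj : j ∈ t.map Prod.fst)
    (hu : u ∈ t.map Prod.snd) (hju : p j u = 0) : pairProd p t = 0 := by
  obtain ⟨t', -, -, h⟩ := exists_pairProd_eq_mul p hp t j u hj hu
  rw [h, hju, zero_mul]

theorem pairProd_mem_span (s : Finset ι) (W : ι → Submodule K U) (hW : ∀ j, ∀ u ∈ W j, p j u = 0)
    (D : ℕ) (y : ℕ → U) (η : ℕ → U →ₗ[K] K)
    (hy : ∀ u, u - ∑ i ∈ Finset.range D, η i u • y i ∈ ⨆ j ∈ s, W j)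
    (t : Multiset (ι × U)) (t0 : Multiset (ι × ℕ)) (ht0 : ∀ x ∈ t0, x.2 < D)
    (hs : ∀ j ∈ s, j ∈ t0.map Prod.fst + t.map Prod.fst) :
    pairProd p (t0.map (Prod.map id y)) * pairProd p t ∈
      Submodule.span K {z | ∃ t' : Multiset (ι × ℕ), (∀ x ∈ t', x.2 < D) ∧
        t'.map Prod.fst = t0.map Prod.fst + t.map Prod.fst ∧
        z = pairProd p (t'.map (Prod.map id y))} := by
  induction t using Multiset.induction_on generalizing t0 with
  | empty =>
    refine Submodule.subset_span ⟨t0, ht0, by simp, by simp [pairProd]⟩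
  | cons x t ih =>
    obtain ⟨j, u⟩ := x
    have hker : ∀ w ∈ ⨆ j ∈ s, W j,
        pairProd p (t0.map (Prod.map id y)) * (p j w * pairProd p t) = 0 := by
      let f : U →ₗ[K] R := (LinearMap.mulLeft K (pairProd p (t0.map (Prod.map id y)))).comp
        ((LinearMap.mulRight K (pairProd p t)).comp (p j))
      suffices h : ⨆ j ∈ s, W j ≤ LinearMap.ker f by
        intro w hw
        exact h hw
      refine iSup₂_le fun j' hj' w hw => ?_
      change pairProd p (t0.map (Prod.map id y)) * (p j w * pairProd p t) = 0
      rw [← pairProd_cons p (j, w), ← pairProd_add]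
      refine pairProd_eq_zero p hp _ j' w ?_ ?_ (hW j' w hw)
      · simpa using hs j' hj'
      · simp
    set w := u - ∑ i ∈ Finset.range D, η i u • y i with hw
    have hu : p j u = ∑ i ∈ Finset.range D, η i u • p j (y i) + p j w := by
      rw [hw, map_sub, map_sum]
      simp only [map_smul]
      ring
    rw [pairProd_cons, hu, add_mul, mul_add, hker w (hy u), add_zero, Finset.sum_mul,
      Finset.mul_sum]
    refine Submodule.sum_mem _ fun i hi => ?_
    have h1 := ih ((j, i) ::ₘ t0)
      (by
        intro x hx
        rcases Multiset.mem_cons.mp hx with rfl | hx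
        · exact Finset.mem_range.mp hi
        · exact ht0 x hx)
      (by
        intro j' hj'
        have := hs j' hj'
        simp only [Multiset.map_cons, Multiset.mem_add, Multiset.mem_cons] at this ⊢
        tauto)
    have h2 : pairProd p (t0.map (Prod.map id y)) * (η i u • p j (y i) * pairProd p t) =
        η i u • (pairProd p (((j, i) ::ₘ t0).map (Prod.map id y)) * pairProd p t) := by
      rw [Multiset.map_cons, pairProd_cons, smul_mul_assoc, mul_smul_comm]
      congr 1
      simp only [Prod.map_apply, id]
      ring
    have h3 : ((j, i) ::ₘ t0).map Prod.fst + t.map Prod.fst =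
        t0.map Prod.fst + ((j, u) ::ₘ t).map Prod.fst := by
      simp
    rw [h2]
    rw [h3] at h1
    exact Submodule.smul_mem _ _ h1

end PairProd

/-- A finite family of vectors which is a basis modulo the subspace `W`, together with the
coordinate functionals, extended to the whole space. -/
structure SplitBasis {K U : Type*} [Field K] [AddCommGroup U] [Module K U]
    (W : Submodule K U) where
  dim : ℕ
  vec : ℕ → U
  coord : ℕ → U →ₗ[K] K
  coord_vec : ∀ i < dim, ∀ k < dim, coord i (vec k) = if i = k then 1 else 0
  coord_eq_zero : ∀ i, ∀ w ∈ W, coord i w = 0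
  sub_sum_mem : ∀ u, u - ∑ i ∈ Finset.range dim, coord i u • vec i ∈ W

/-- A basis modulo `W`. -/
def splitBasis {K U : Type*} [Field K] [AddCommGroup U] [Module K U]
    [FiniteDimensional K U] (W : Submodule K U) : SplitBasis W := by
  apply Classical.choice
  set d := Module.finrank K (U ⧸ W) with hd
  let b := Module.finBasis K (U ⧸ W)
  choose g hg using W.mkQ_surjective
  refine ⟨d, fun k => if h : k < d then g (b ⟨k, h⟩) else 0,
    fun i => if h : i < d then (b.coord ⟨i, h⟩).comp W.mkQ else 0, ?_, ?_, ?_⟩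
  · intro i hi k hk
    simp only [dif_pos hi, dif_pos hk, LinearMap.comp_apply, hg, Module.Basis.coord_apply,
      Module.Basis.repr_self, Finsupp.single_apply, Fin.mk.injEq, eq_comm]
  · intro i w hw
    split_ifs
    · have : W.mkQ w = 0 := by simpa using hw
      rw [LinearMap.comp_apply, this, map_zero]
    · simp
  · intro u
    refine (Submodule.Quotient.mk_eq_zero W).mp ?_
    change W.mkQ _ = 0
    rw [map_sub, map_sum, sub_eq_zero]
    conv_lhs => rw [← b.sum_repr (W.mkQ u)]
    rw [Finset.sum_range]
    refine Finset.sum_congr rfl fun i _ => ?_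
    have hi : (i : ℕ) < d := i.2
    simp only [dif_pos hi, map_smul, hg, LinearMap.comp_apply, Module.Basis.coord_apply]

section BlockWeight

variable {ι : Type*} [Fintype ι] [DecidableEq ι]

/-- The multigrading in which the variables of the block `j` have degree `e_j`. -/
def blockWeight (α : ι → Type*) : (Σ j, α j) → ι → ℕ := fun z => Pi.single z.1 1

theorem weight_blockWeight_apply {α : ι → Type*} (d : (Σ j, α j) →₀ ℕ) (j : ι) :
    Finsupp.weight (blockWeight α) d j = (Finsupp.sigmaFinsuppEquivPiFinsupp d j).sum fun _ k => k := by
  induction d using Finsupp.induction_linear with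
  | zero =>
    have : Finsupp.sigmaFinsuppEquivPiFinsupp (0 : (Σ j, α j) →₀ ℕ) j = 0 := by
      ext z
      simp
    rw [this]
    simp
  | add f g hf hg =>
    rw [map_add, Pi.add_apply, hf, hg, ← Finsupp.sum_add_index' (fun _ => rfl) fun _ _ _ => rfl]
    congr 1
    ext z
    simp
  | single z k =>
    obtain ⟨i, z⟩ := z
    rw [Finsupp.weight_single, Pi.smul_apply, blockWeight]
    by_cases h : i = j
    · subst h
      have : Finsupp.sigmaFinsuppEquivPiFinsupp (Finsupp.single (⟨i, z⟩ : Σ j, α j) k) i =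
          Finsupp.single z k := by
        ext z'
        classical
        simp [Finsupp.single_apply]
      rw [this]
      simp
    · have : Finsupp.sigmaFinsuppEquivPiFinsupp (Finsupp.single (⟨i, z⟩ : Σ j, α j) k) j = 0 := by
        ext z'
        classical
        simp [h]
      rw [this]
      simp [Ne.symm h]

/-- The exponents of degree `d` in `c j` variables in each block `j`. -/
def boundedExps (c d : ι → ℕ) : Finset ((Σ _ : ι, ℕ) →₀ ℕ) :=
  (Fintype.piFinset fun j => Finset.finsuppAntidiag (Finset.range (c j)) (d j)).map
    (Finsupp.sigmaFinsuppEquivPiFinsupp (ιs := fun _ : ι => ℕ) (α := ℕ)).symm.toEmbedding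

theorem card_boundedExps (c d : ι → ℕ) :
    (boundedExps c d).card = ∏ j, (c j).multichoose (d j) := by
  rw [boundedExps, Finset.card_map, Fintype.card_piFinset]
  refine Finset.prod_congr rfl fun j _ => ?_
  rw [Finset.card_finsuppAntidiag_nat_eq_multichoose, Finset.card_range]

theorem mem_boundedExps {c d : ι → ℕ} {m : (Σ _ : ι, ℕ) →₀ ℕ} :
    m ∈ boundedExps c d ↔
      (∀ z ∈ m.support, z.2 < c z.1) ∧ Finsupp.weight (blockWeight fun _ => ℕ) m = d := by
  rw [boundedExps, Finset.mem_map_equiv, Equiv.symm_symm, Fintype.mem_piFinset, funext_iff]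
  simp only [Finset.mem_finsuppAntidiag', forall_and, weight_blockWeight_apply]
  rw [and_comm]
  refine and_congr ?_ Iff.rfl
  constructor
  · rintro h ⟨j, k⟩ hz
    exact Finset.mem_range.mp (h j (by simpa using hz))
  · intro h j k hk
    exact Finset.mem_range.mpr (h ⟨j, k⟩ (by simpa using hk))

end BlockWeight

section Factor

variable {K U V T : Type*} [Field K] [AddCommGroup U] [Module K U] [AddCommGroup V] [Module K V]
  [AddCommGroup T] [Module K T]

theorem exists_comp_eq_of_ker_le (f : U →ₗ[K] V) (g : U →ₗ[K] T)
    (h : LinearMap.ker f ≤ LinearMap.ker g) : ∃ k : V →ₗ[K] T, ∀ u, k (f u) = g u := by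
  obtain ⟨r, hr⟩ := f.rangeRestrict.exists_rightInverse_of_surjective f.range_rangeRestrict
  obtain ⟨k, hk⟩ := LinearMap.exists_extend (g.comp r)
  refine ⟨k, fun u => ?_⟩
  have h1 : k (f u) = g (r (f.rangeRestrict u)) := LinearMap.congr_fun hk (f.rangeRestrict u)
  have h2 : f (r (f.rangeRestrict u)) = f u :=
    congrArg Subtype.val (LinearMap.congr_fun hr (f.rangeRestrict u))
  rw [h1, ← sub_eq_zero, ← map_sub]
  exact h (by rw [LinearMap.mem_ker, map_sub, h2, sub_self])

theorem exists_eq_and_vec_eq (f : U →ₗ[K] V) (B : SplitBasis (LinearMap.range f)) (g : U →ₗ[K] T)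
    (h : LinearMap.ker f ≤ LinearMap.ker g) (q : ℕ → T) :
    ∃ k : V →ₗ[K] T, (∀ u, k (f u) = g u) ∧ ∀ i < B.dim, k (B.vec i) = q i := by
  obtain ⟨k, hk⟩ := exists_comp_eq_of_ker_le f g h
  refine ⟨k + ∑ i ∈ Finset.range B.dim, (B.coord i).smulRight (q i - k (B.vec i)), ?_, ?_⟩
  · intro u
    simp [hk, B.coord_eq_zero _ (f u) ⟨u, rfl⟩]
  · intro i hi
    rw [LinearMap.add_apply, LinearMap.sum_apply, Finset.sum_eq_single i]
    · simp [B.coord_vec i hi i hi]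
    · intro b hb hne
      simp [B.coord_vec b (Finset.mem_range.mp hb) i hi, hne]
    · exact fun hni => absurd (Finset.mem_range.mpr hi) hni

end Factor

section Swap

set_option linter.unusedSectionVars false

variable {K ι U : Type*} [Field K] [Fintype ι] [DecidableEq ι] [AddCommGroup U] [Module K U]
  [FiniteDimensional K U] {α : ι → Type*} [∀ j, Fintype (α j)] [∀ j, DecidableEq (α j)]

variable (K α) in
/-- The linear form in the variables of the block `j` with the given coefficients. -/
def blockForm (j : ι) : (α j → K) →ₗ[K] MvPolynomial (Σ j, α j) K :=
  Fintype.linearCombination K fun k => X ⟨j, k⟩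

theorem blockForm_apply (j : ι) (u : α j → K) :
    blockForm K α j u = ∑ k, u k • X ⟨j, k⟩ := rfl

theorem blockForm_single (j : ι) (k : α j) :
    blockForm K α j (Pi.single k 1) = X ⟨j, k⟩ := by
  simp [blockForm]

theorem isWeightedHomogeneous_blockForm (j : ι) (u : α j → K) :
    (blockForm K α j u).IsWeightedHomogeneous (blockWeight α) (Pi.single j 1) := by
  rw [blockForm_apply]
  refine Submodule.sum_mem (weightedHomogeneousSubmodule K (blockWeight α) _) fun k _ => ?_
  exact Submodule.smul_mem _ _ (isWeightedHomogeneous_X K (blockWeight α) (⟨j, k⟩ : Σ j, α j))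

variable (φ : ∀ j, U →ₗ[K] (α j → K))

/-- The linear form in the variables of the block `j` attached to a vector of `U`. -/
def blockMap (j : ι) : U →ₗ[K] MvPolynomial (Σ j, α j) K :=
  (blockForm K α j).comp (φ j)

theorem isWeightedHomogeneous_blockMap (j : ι) (u : U) :
    (blockMap φ j u).IsWeightedHomogeneous (blockWeight α) (Pi.single j 1) :=
  isWeightedHomogeneous_blockForm j _

/-- The ideal of the `2`-minors with rows indexed by vectors and columns indexed by blocks. -/
def swapIdeal : Ideal (MvPolynomial (Σ j, α j) K) :=
  Ideal.span {f | ∃ j j' u u',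
    f = blockMap φ j u * blockMap φ j' u' - blockMap φ j' u * blockMap φ j u'}

theorem weightedHomogeneousComponent_mem_swapIdeal (f : MvPolynomial (Σ j, α j) K)
    (hf : f ∈ swapIdeal φ) (a : ι → ℕ) :
    weightedHomogeneousComponent (blockWeight α) a f ∈ swapIdeal φ := by
  let _ := weightedGradedAlgebra K (blockWeight α)
  refine weightedHomogeneousComponent_mem_of_mem K (blockWeight α) ?_ hf a
  refine Ideal.homogeneous_span _ _ ?_
  rintro _ ⟨j, j', u, u', rfl⟩
  refine ⟨Pi.single j 1 + Pi.single j' 1, Submodule.sub_mem _ ?_ ?_⟩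
  · exact (isWeightedHomogeneous_blockMap φ j u).mul (isWeightedHomogeneous_blockMap φ j' u')
  · rw [add_comm]
    exact (isWeightedHomogeneous_blockMap φ j' u).mul (isWeightedHomogeneous_blockMap φ j u')

/-- A basis of the cokernel of `φ j`. -/
def cokerBasis (j : ι) : SplitBasis (LinearMap.range (φ j)) := splitBasis _

/-- A basis of the quotient of `U` by the sum of the kernels of the `φ j`, `j ∈ s`. -/
def quotBasis (s : Finset ι) : SplitBasis (⨆ j ∈ s, LinearMap.ker (φ j)) := splitBasis _

theorem exists_evaluation (s : Finset ι) :
    ∃ Φ : MvPolynomial (Σ j, α j) K →ₐ[K] MvPolynomial (Σ _ : ι, ℕ) (MvPolynomial ℕ K),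
      (∀ j u, Φ (blockMap φ j u) = C (if j ∈ s then
        ∑ i ∈ Finset.range (quotBasis φ s).dim, (quotBasis φ s).coord i u • X i else 0)) ∧
      ∀ j, ∀ i < (cokerBasis φ j).dim,
        Φ (blockForm K α j ((cokerBasis φ j).vec i)) = X ⟨j, i⟩ := by
  let l : U →ₗ[K] MvPolynomial ℕ K :=
    ∑ i ∈ Finset.range (quotBasis φ s).dim, ((quotBasis φ s).coord i).smulRight (X i)
  have hl : ∀ u, l u =
      ∑ i ∈ Finset.range (quotBasis φ s).dim, (quotBasis φ s).coord i u • X i := by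
    intro u
    simp [l]
  let g : ι → U →ₗ[K] MvPolynomial (Σ _ : ι, ℕ) (MvPolynomial ℕ K) := fun j =>
    (Algebra.linearMap (MvPolynomial ℕ K)
      (MvPolynomial (Σ _ : ι, ℕ) (MvPolynomial ℕ K))).restrictScalars K ∘ₗ
        (if j ∈ s then l else 0)
  have hg : ∀ j u, g j u = C (if j ∈ s then
        ∑ i ∈ Finset.range (quotBasis φ s).dim, (quotBasis φ s).coord i u • X i else 0) := by
    intro j u
    rw [← hl]
    change C ((if j ∈ s then l else 0) u) = _
    split_ifs <;> rfl
  have hker : ∀ j, LinearMap.ker (φ j) ≤ LinearMap.ker (g j) := by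
    intro j u hu
    rw [LinearMap.mem_ker, hg]
    split_ifs with hj
    · rw [Finset.sum_eq_zero, C_0]
      intro i _
      rw [(quotBasis φ s).coord_eq_zero i u ((le_iSup₂_of_le j hj le_rfl :
        LinearMap.ker (φ j) ≤ _) hu), zero_smul]
    · exact C_0
  choose L hL1 hL2 using fun j =>
    exists_eq_and_vec_eq (φ j) (cokerBasis φ j) (g j) (hker j) fun i => X ⟨j, i⟩
  let Φ : MvPolynomial (Σ j, α j) K →ₐ[K] MvPolynomial (Σ _ : ι, ℕ) (MvPolynomial ℕ K) :=
    aeval fun z => L z.1 (Pi.single z.2 1)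
  have hΦ : ∀ j u, Φ (blockForm K α j u) = L j u := by
    intro j u
    rw [blockForm_apply, map_sum]
    conv_rhs => rw [pi_eq_sum_univ' u, map_sum]
    refine Finset.sum_congr rfl fun k _ => ?_
    rw [map_smul, map_smul, aeval_X]
  refine ⟨Φ, fun j u => ?_, fun j i hi => ?_⟩
  · rw [← hg, ← hL1, ← hΦ]
    rfl
  · rw [hΦ, hL2 j i hi]

/-- An algebra map killing the minors; see `evaluation_blockMap`. -/
def evaluation (s : Finset ι) :
    MvPolynomial (Σ j, α j) K →ₐ[K] MvPolynomial (Σ _ : ι, ℕ) (MvPolynomial ℕ K) :=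
  (exists_evaluation φ s).choose

theorem evaluation_blockMap (s : Finset ι) (j : ι) (u : U) :
    evaluation φ s (blockMap φ j u) = C (if j ∈ s then
      ∑ i ∈ Finset.range (quotBasis φ s).dim, (quotBasis φ s).coord i u • X i else 0) :=
  (exists_evaluation φ s).choose_spec.1 j u

theorem evaluation_blockForm (s : Finset ι) (j : ι) {i : ℕ} (hi : i < (cokerBasis φ j).dim) :
    evaluation φ s (blockForm K α j ((cokerBasis φ j).vec i)) = X ⟨j, i⟩ :=
  (exists_evaluation φ s).choose_spec.2 j i hi

theorem evaluation_eq_zero (s : Finset ι) {f : MvPolynomial (Σ j, α j) K}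
    (hf : f ∈ swapIdeal φ) : evaluation φ s f = 0 := by
  suffices h : swapIdeal φ ≤ RingHom.ker (evaluation φ s) from h hf
  refine Ideal.span_le.mpr ?_
  rintro _ ⟨j, j', u, u', rfl⟩
  rw [SetLike.mem_coe, RingHom.mem_ker, map_sub, map_mul, map_mul]
  simp only [evaluation_blockMap]
  split_ifs <;> simp

theorem evaluation_blockMap_vec {s : Finset ι} {j : ι} (hj : j ∈ s) {i : ℕ}
    (hi : i < (quotBasis φ s).dim) :
    evaluation φ s (blockMap φ j ((quotBasis φ s).vec i)) = C (X i) := by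
  rw [evaluation_blockMap, if_pos hj, Finset.sum_eq_single i]
  · rw [(quotBasis φ s).coord_vec i hi i hi, if_pos rfl, one_smul]
  · intro k hk hne
    rw [(quotBasis φ s).coord_vec k (Finset.mem_range.mp hk) i hi, if_neg hne, zero_smul]
  · exact fun h => absurd (Finset.mem_range.mpr hi) h

/-- The product of the linear forms attached to the cokernels, with exponents `m`. -/
def cokerProd (m : (Σ _ : ι, ℕ) →₀ ℕ) : MvPolynomial (Σ j, α j) K :=
  m.prod fun z k => blockForm K α z.1 ((cokerBasis φ z.1).vec z.2) ^ k

theorem cokerProd_add (m m' : (Σ _ : ι, ℕ) →₀ ℕ) :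
    cokerProd φ (m + m') = cokerProd φ m * cokerProd φ m' :=
  Finsupp.prod_add_index' (fun _ => pow_zero _) fun _ _ _ => pow_add _ _ _

theorem cokerProd_single (z : Σ _ : ι, ℕ) :
    cokerProd φ (Finsupp.single z 1) = blockForm K α z.1 ((cokerBasis φ z.1).vec z.2) :=
  (Finsupp.prod_single_index (h := fun (z : Σ _ : ι, ℕ) (k : ℕ) =>
    blockForm K α z.1 ((cokerBasis φ z.1).vec z.2) ^ k) (pow_zero _)).trans (pow_one _)

theorem isWeightedHomogeneous_cokerProd (m : (Σ _ : ι, ℕ) →₀ ℕ) :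
    (cokerProd φ m).IsWeightedHomogeneous (blockWeight α)
      (Finsupp.weight (blockWeight fun _ => ℕ) m) := by
  rw [Finsupp.weight_apply]
  exact IsWeightedHomogeneous.prod _ _ _ fun z _ =>
    (isWeightedHomogeneous_blockForm z.1 _).pow _

theorem evaluation_cokerProd (s : Finset ι) {m : (Σ _ : ι, ℕ) →₀ ℕ}
    (hm : ∀ z ∈ m.support, z.2 < (cokerBasis φ z.1).dim) :
    evaluation φ s (cokerProd φ m) = monomial m 1 := by
  rw [cokerProd, monomial_eq, C_1, one_mul, Finsupp.prod, Finsupp.prod, map_prod]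
  refine Finset.prod_congr rfl fun z hz => ?_
  rw [map_pow, evaluation_blockForm φ s _ (hm z hz)]

/-- A multiset of pairs with given projections, if there is one. -/
def pairing {β γ : Type*} (J : Multiset β) (L : Multiset γ) : Multiset (β × γ) :=
  open Classical in
  if h : J.card = L.card then (exists_multiset_prod_map_fst_snd J L h).choose else 0

theorem map_fst_pairing {β γ : Type*} {J : Multiset β} {L : Multiset γ} (h : J.card = L.card) :
    (pairing J L).map Prod.fst = J := by
  rw [pairing, dif_pos h]
  exact (exists_multiset_prod_map_fst_snd J L h).choose_spec.1

theorem map_snd_pairing {β γ : Type*} {J : Multiset β} {L : Multiset γ} (h : J.card = L.card) :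
    (pairing J L).map Prod.snd = L := by
  rw [pairing, dif_pos h]
  exact (exists_multiset_prod_map_fst_snd J L h).choose_spec.2

/-- The element of the spanning family attached to a multiset of blocks, exponents of the
cokernel forms and a multiset of indices of basis vectors. -/
def spanElem (J : Multiset ι) (m : (Σ _ : ι, ℕ) →₀ ℕ) (L : Multiset ℕ) :
    MvPolynomial (Σ j, α j) K :=
  cokerProd φ m *
    pairProd (blockMap φ) ((pairing J L).map (Prod.map id (quotBasis φ J.toFinset).vec))

theorem isWeightedHomogeneous_pairProd (t : Multiset (ι × U)) :
    (pairProd (blockMap φ) t).IsWeightedHomogeneous (blockWeight α)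
      fun j => (t.map Prod.fst).count j := by
  induction t using Multiset.induction_on with
  | empty => exact isWeightedHomogeneous_one K _
  | cons x t ih =>
    rw [pairProd_cons]
    convert (isWeightedHomogeneous_blockMap φ x.1 x.2).mul ih using 1
    ext j
    rw [Multiset.map_cons, Multiset.count_cons, Pi.add_apply, Pi.single_apply, add_comm]

theorem isWeightedHomogeneous_spanElem {J : Multiset ι} (m : (Σ _ : ι, ℕ) →₀ ℕ)
    {L : Multiset ℕ} (h : J.card = L.card) :
    (spanElem φ J m L).IsWeightedHomogeneous (blockWeight α)
      ((fun j => J.count j) + Finsupp.weight (blockWeight fun _ => ℕ) m) := by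
  have h1 := isWeightedHomogeneous_pairProd φ
    ((pairing J L).map (Prod.map id (quotBasis φ J.toFinset).vec))
  have h2 : ((pairing J L).map (Prod.map id (quotBasis φ J.toFinset).vec)).map Prod.fst = J := by
    rw [Multiset.map_map]
    exact map_fst_pairing h
  rw [h2] at h1
  rw [add_comm]
  exact (isWeightedHomogeneous_cokerProd φ m).mul h1

theorem exists_evaluation_pairProd (s : Finset ι) (t : Multiset (ι × U)) :
    ∃ q, evaluation φ s (pairProd (blockMap φ) t) = C q := by
  induction t using Multiset.induction_on with
  | empty => exact ⟨1, by simp [pairProd]⟩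
  | cons x t ih =>
    obtain ⟨q, hq⟩ := ih
    rw [pairProd_cons, map_mul, hq, evaluation_blockMap, ← C_mul]
    exact ⟨_, rfl⟩

theorem evaluation_pairProd_vec (s : Finset ι) (t : Multiset (ι × ℕ)) (h1 : ∀ x ∈ t, x.1 ∈ s)
    (h2 : ∀ x ∈ t, x.2 < (quotBasis φ s).dim) :
    evaluation φ s (pairProd (blockMap φ) (t.map (Prod.map id (quotBasis φ s).vec))) =
      C (monomial (Multiset.toFinsupp (t.map Prod.snd)) 1) := by
  induction t using Multiset.induction_on with
  | empty => simp [pairProd]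
  | cons x t ih =>
    rw [Multiset.map_cons, pairProd_cons, map_mul,
      ih (fun x hx => h1 x (Multiset.mem_cons_of_mem hx))
        (fun x hx => h2 x (Multiset.mem_cons_of_mem hx)), Prod.map_fst, Prod.map_snd, id,
      evaluation_blockMap_vec φ (h1 x (Multiset.mem_cons_self _ _))
        (h2 x (Multiset.mem_cons_self _ _)), ← C_mul, X, monomial_mul, one_mul,
      Multiset.map_cons, ← Multiset.singleton_add, map_add, Multiset.toFinsupp_singleton]

theorem evaluation_spanElem {J : Multiset ι} {m : (Σ _ : ι, ℕ) →₀ ℕ} {L : Multiset ℕ}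
    (h : J.card = L.card) (hm : ∀ z ∈ m.support, z.2 < (cokerBasis φ z.1).dim)
    (hL : ∀ i ∈ L, i < (quotBasis φ J.toFinset).dim) :
    evaluation φ J.toFinset (spanElem φ J m L) = monomial m (monomial (Multiset.toFinsupp L) 1) := by
  rw [spanElem, map_mul, evaluation_cokerProd φ _ hm, evaluation_pairProd_vec, map_snd_pairing h,
    mul_comm, C_mul_monomial, mul_one]
  · intro x hx
    rw [Multiset.mem_toFinset, ← map_fst_pairing h]
    exact Multiset.mem_map_of_mem _ hx
  · intro x hx
    refine hL x.2 ?_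
    rw [← map_snd_pairing h]
    exact Multiset.mem_map_of_mem _ hx

theorem coeff_evaluation_spanElem_of_ne (s : Finset ι) {J : Multiset ι}
    {m m' : (Σ _ : ι, ℕ) →₀ ℕ} {L : Multiset ℕ}
    (hm : ∀ z ∈ m.support, z.2 < (cokerBasis φ z.1).dim) (hne : m ≠ m') :
    coeff m' (evaluation φ s (spanElem φ J m L)) = 0 := by
  obtain ⟨q, hq⟩ := exists_evaluation_pairProd φ s
    ((pairing J L).map (Prod.map id (quotBasis φ J.toFinset).vec))
  rw [spanElem, map_mul, evaluation_cokerProd φ _ hm, hq, mul_comm, C_mul_monomial,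
    coeff_monomial, if_neg hne]

end Swap

section Spanning

set_option linter.unusedSectionVars false

variable {K ι U : Type*} [Field K] [Fintype ι] [DecidableEq ι] [AddCommGroup U] [Module K U]
  [FiniteDimensional K U] {α : ι → Type*} [∀ j, Fintype (α j)] [∀ j, DecidableEq (α j)]
  (φ : ∀ j, U →ₗ[K] (α j → K))

/-- The residue classes of the spanning elements of degree `a`. -/
def spanSet (a : ι → ℕ) : Set (MvPolynomial (Σ j, α j) K ⧸ swapIdeal φ) :=
  {z | ∃ (J : Multiset ι) (m : (Σ _ : ι, ℕ) →₀ ℕ) (L : Multiset ℕ), J.card = L.card ∧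
    (∀ z ∈ m.support, z.2 < (cokerBasis φ z.1).dim) ∧
    (∀ i ∈ L, i < (quotBasis φ J.toFinset).dim) ∧
    (fun j => J.count j) + Finsupp.weight (blockWeight fun _ => ℕ) m = a ∧
    z = Ideal.Quotient.mkₐ K (swapIdeal φ) (spanElem φ J m L)}

/-- The residue class of `blockMap φ j`. -/
def blockMapQuot (j : ι) : U →ₗ[K] MvPolynomial (Σ j, α j) K ⧸ swapIdeal φ :=
  (Ideal.Quotient.mkₐ K (swapIdeal φ)).toLinearMap ∘ₗ blockMap φ j

theorem blockMapQuot_mul (j j' : ι) (u u' : U) :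
    blockMapQuot φ j u * blockMapQuot φ j' u' = blockMapQuot φ j' u * blockMapQuot φ j u' := by
  rw [← sub_eq_zero]
  exact Ideal.Quotient.eq_zero_iff_mem.mpr (Ideal.subset_span ⟨j, j', u, u', rfl⟩)

theorem mk_pairProd (t : Multiset (ι × U)) :
    Ideal.Quotient.mkₐ K (swapIdeal φ) (pairProd (blockMap φ) t) =
      pairProd (blockMapQuot φ) t := by
  rw [pairProd, map_multiset_prod, Multiset.map_map]
  rfl

theorem mk_X_mul_mem_span {a : ι → ℕ} (j : ι) (k : α j)
    {x : MvPolynomial (Σ j, α j) K ⧸ swapIdeal φ} (hx : x ∈ Submodule.span K (spanSet φ a)) :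
    Ideal.Quotient.mkₐ K (swapIdeal φ) (X ⟨j, k⟩) * x ∈
      Submodule.span K (spanSet φ (Pi.single j 1 + a)) := by
  suffices h : Submodule.span K (spanSet φ a) ≤ (Submodule.span K (spanSet φ (Pi.single j 1 + a))).comap
      (LinearMap.mulLeft K (Ideal.Quotient.mkₐ K (swapIdeal φ) (X ⟨j, k⟩))) from h hx
  refine Submodule.span_le.mpr ?_
  rintro _ ⟨J, m, L, hJL, hm, hL, ha, rfl⟩
  change Ideal.Quotient.mkₐ K (swapIdeal φ) (X ⟨j, k⟩) * _ ∈ Submodule.span K _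
  obtain ⟨u, hu⟩ := (cokerBasis φ j).sub_sum_mem (Pi.single k 1)
  have hX : (X ⟨j, k⟩ : MvPolynomial (Σ j, α j) K) = blockMap φ j u +
      ∑ i ∈ Finset.range (cokerBasis φ j).dim, (cokerBasis φ j).coord i (Pi.single k 1) •
        blockForm K α j ((cokerBasis φ j).vec i) := by
    rw [← blockForm_single, blockMap, LinearMap.comp_apply, hu, map_sub, map_sum]
    simp only [map_smul]
    rw [sub_add_cancel]
  rw [hX, map_add, add_mul, map_sum, Finset.sum_mul]
  refine Submodule.add_mem _ ?_ (Submodule.sum_mem _ fun i hi => ?_)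
  · have h1 := pairProd_mem_span (blockMapQuot φ) (blockMapQuot_mul φ) (j ::ₘ J).toFinset
      (fun j => LinearMap.ker (φ j))
      (fun j u hu => by
        rw [blockMapQuot, LinearMap.comp_apply, blockMap, LinearMap.comp_apply,
          LinearMap.mem_ker.mp hu, map_zero, map_zero])
      (quotBasis φ (j ::ₘ J).toFinset).dim (quotBasis φ (j ::ₘ J).toFinset).vec
      (quotBasis φ (j ::ₘ J).toFinset).coord (quotBasis φ (j ::ₘ J).toFinset).sub_sum_mem
      ((j, u) ::ₘ (pairing J L).map (Prod.map id (quotBasis φ J.toFinset).vec)) 0 (by simp)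
    have h2 : ((j, u) ::ₘ (pairing J L).map (Prod.map id (quotBasis φ J.toFinset).vec)).map
        Prod.fst = j ::ₘ J := by
      rw [Multiset.map_cons, Multiset.map_map]
      conv_rhs => rw [← map_fst_pairing hJL]
      rfl
    rw [h2] at h1
    have h3 := h1 (by simp)
    rw [pairProd_cons] at h3
    have h4 : Ideal.Quotient.mkₐ K (swapIdeal φ) (blockMap φ j u) *
        Ideal.Quotient.mkₐ K (swapIdeal φ) (spanElem φ J m L) =
        LinearMap.mulLeft K (Ideal.Quotient.mkₐ K (swapIdeal φ) (cokerProd φ m))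
          (pairProd (blockMapQuot φ) ((0 : Multiset (ι × ℕ)).map
            (Prod.map id (quotBasis φ (j ::ₘ J).toFinset).vec)) * (blockMapQuot φ j u *
            pairProd (blockMapQuot φ)
              ((pairing J L).map (Prod.map id (quotBasis φ J.toFinset).vec)))) := by
      rw [spanElem, map_mul, mk_pairProd, LinearMap.mulLeft_apply]
      simp only [pairProd, Multiset.map_zero, Multiset.prod_zero, one_mul]
      exact mul_left_comm _ _ _
    rw [h4]
    refine (Submodule.span_le (p := (Submodule.span K (spanSet φ (Pi.single j 1 + a))).comap
      (LinearMap.mulLeft K (Ideal.Quotient.mkₐ K (swapIdeal φ) (cokerProd φ m))))).mpr ?_ h3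
    rintro _ ⟨t', ht1, ht2, rfl⟩
    have ht2 : t'.map Prod.fst = j ::ₘ J := by simpa using ht2
    have hcard : (j ::ₘ J).card = (t'.map Prod.snd).card := by
      rw [← ht2, Multiset.card_map, Multiset.card_map]
    refine Submodule.subset_span ⟨j ::ₘ J, m, t'.map Prod.snd, hcard, hm, ?_, ?_, ?_⟩
    · intro i hi
      obtain ⟨x, hx, rfl⟩ := Multiset.mem_map.mp hi
      exact ht1 x hx
    · rw [← ha, ← add_assoc]
      congr 1
      ext j'
      rw [Multiset.count_cons, Pi.add_apply, Pi.single_apply, add_comm]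
    · rw [spanElem, map_mul, mk_pairProd, LinearMap.mulLeft_apply]
      congr 1
      refine pairProd_eq_of_map_eq (blockMapQuot φ) (blockMapQuot_mul φ) _ _ ?_ ?_
      · rw [Multiset.map_map, Multiset.map_map]
        exact ht2.trans (map_fst_pairing hcard).symm
      · have := congrArg (Multiset.map (quotBasis φ (j ::ₘ J).toFinset).vec)
          (map_snd_pairing hcard)
        rw [Multiset.map_map, Multiset.map_map] at this
        rw [Multiset.map_map, Multiset.map_map]
        exact this.symm
  · rw [map_smul, smul_mul_assoc]
    refine Submodule.smul_mem _ _ (Submodule.subset_span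
      ⟨J, Finsupp.single ⟨j, i⟩ 1 + m, L, hJL, ?_, hL, ?_, ?_⟩)
    · intro z hz
      rcases Finset.mem_union.mp (Finsupp.support_add hz) with hz | hz
      · have := Finsupp.support_single_subset hz
        rw [Finset.mem_singleton] at this
        subst this
        exact Finset.mem_range.mp hi
      · exact hm z hz
    · rw [map_add, ← ha, Finsupp.weight_single, one_smul]
      exact add_left_comm _ _ _
    · rw [spanElem, spanElem, cokerProd_add, cokerProd_single, mul_assoc, ← map_mul]

theorem mk_monomial_mem_span (d : (Σ j, α j) →₀ ℕ) :
    Ideal.Quotient.mkₐ K (swapIdeal φ) (monomial d 1) ∈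
      Submodule.span K (spanSet φ (Finsupp.weight (blockWeight α) d)) := by
  obtain ⟨M, rfl⟩ := Multiset.toFinsupp.surjective d
  induction M using Multiset.induction_on with
  | empty =>
    refine Submodule.subset_span ⟨0, 0, 0, rfl, by simp, by simp, ?_, ?_⟩
    · ext j
      simp
    · have : pairing (0 : Multiset ι) (0 : Multiset ℕ) = 0 := by
        have := map_fst_pairing (J := (0 : Multiset ι)) (L := (0 : Multiset ℕ)) rfl
        simpa using this
      simp [spanElem, cokerProd, pairProd, this]
  | cons z M ih =>
    obtain ⟨j, k⟩ := z
    have h := mk_X_mul_mem_span φ j k ih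
    rw [← Multiset.singleton_add, map_add, Multiset.toFinsupp_singleton, map_add,
      Finsupp.weight_single, one_smul]
    rw [← map_mul, X, monomial_mul, one_mul] at h
    exact h

end Spanning

section Counting

set_option linter.unusedSectionVars false

variable {K ι U : Type*} [Field K] [Fintype ι] [DecidableEq ι] [AddCommGroup U] [Module K U]
  [FiniteDimensional K U] {α : ι → Type*} [∀ j, Fintype (α j)] [∀ j, DecidableEq (α j)]
  (φ : ∀ j, U →ₗ[K] (α j → K))

/-- The multiset in which `j` has multiplicity `b j`. -/
def multisetOfCount (b : ι → ℕ) : Multiset ι :=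
  Finsupp.toMultiset (Finsupp.equivFunOnFinite.symm b)

theorem count_multisetOfCount (b : ι → ℕ) (j : ι) : (multisetOfCount b).count j = b j := by
  rw [multisetOfCount, Finsupp.count_toMultiset]
  rfl

theorem multisetOfCount_count (J : Multiset ι) : multisetOfCount (fun j => J.count j) = J := by
  ext j
  rw [count_multisetOfCount]

theorem card_multisetOfCount (b : ι → ℕ) : (multisetOfCount b).card = ∑ j, b j := by
  rw [multisetOfCount, Finsupp.card_toMultiset, Finsupp.sum_fintype _ _ fun _ => rfl]
  rfl

theorem toFinset_multisetOfCount (b : ι → ℕ) :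
    (multisetOfCount b).toFinset = Finset.univ.filter fun j => b j ≠ 0 := by
  ext j
  rw [Multiset.mem_toFinset, ← Multiset.count_ne_zero, count_multisetOfCount]
  simp

/-- The indices of the spanning elements of degree `a`. -/
def spanIndex (a : ι → ℕ) : Finset (Σ _ : ι → ℕ, ((Σ _ : ι, ℕ) →₀ ℕ) × (ℕ →₀ ℕ)) :=
  (Fintype.piFinset fun j => Finset.range (a j + 1)).sigma fun b =>
    boundedExps (fun j => (cokerBasis φ j).dim) (fun j => a j - b j) ×ˢ
      Finset.finsuppAntidiag (Finset.range (quotBasis φ (multisetOfCount b).toFinset).dim)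
        (∑ j, b j)

theorem mem_spanIndex {a b : ι → ℕ} {m : (Σ _ : ι, ℕ) →₀ ℕ} {e : ℕ →₀ ℕ} :
    ⟨b, m, e⟩ ∈ spanIndex φ a ↔ (∀ z ∈ m.support, z.2 < (cokerBasis φ z.1).dim) ∧
      b + Finsupp.weight (blockWeight fun _ => ℕ) m = a ∧
      (multisetOfCount b).card = (Finsupp.toMultiset e).card ∧
      ∀ i ∈ Finsupp.toMultiset e, i < (quotBasis φ (multisetOfCount b).toFinset).dim := by
  rw [spanIndex, Finset.mem_sigma, Finset.mem_product, mem_boundedExps,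
    Finset.mem_finsuppAntidiag', card_multisetOfCount, Finsupp.card_toMultiset,
    Fintype.mem_piFinset]
  have h1 : (∀ i ∈ Finsupp.toMultiset e, i < (quotBasis φ (multisetOfCount b).toFinset).dim) ↔
      e.support ⊆ Finset.range (quotBasis φ (multisetOfCount b).toFinset).dim := by
    simp only [Finsupp.mem_toMultiset, Finset.subset_iff, Finset.mem_range]
  have h2 : ((∀ j, b j ∈ Finset.range (a j + 1)) ∧
      Finsupp.weight (blockWeight fun _ => ℕ) m = fun j => a j - b j) ↔
      b + Finsupp.weight (blockWeight fun _ => ℕ) m = a := by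
    simp only [Finset.mem_range, funext_iff, Pi.add_apply, ← forall_and]
    refine forall_congr' fun j => ?_
    omega
  rw [h1, ← h2]
  dsimp only
  constructor
  · rintro ⟨h1, ⟨h2, h3⟩, h4, h5⟩
    exact ⟨h2, ⟨h1, h3⟩, h4.symm, h5⟩
  · rintro ⟨h2, ⟨h1, h3⟩, h4, h5⟩
    exact ⟨h1, ⟨h2, h3⟩, h4.symm, h5⟩

theorem card_spanIndex (a : ι → ℕ) :
    (spanIndex φ a).card = ∑ b ∈ Fintype.piFinset fun j => Finset.range (a j + 1),
      (∏ j, (cokerBasis φ j).dim.multichoose (a j - b j)) *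
        (if (Finset.univ.filter fun j => b j ≠ 0) = ∅ then 1 else
          (quotBasis φ (Finset.univ.filter fun j => b j ≠ 0)).dim).multichoose (∑ j, b j) := by
  rw [spanIndex, Finset.card_sigma]
  refine Finset.sum_congr rfl fun b _ => ?_
  rw [Finset.card_product, card_boundedExps, Finset.card_finsuppAntidiag_nat_eq_multichoose,
    Finset.card_range, toFinset_multisetOfCount]
  split_ifs with h
  · have : ∑ j, b j = 0 := by
      rw [Finset.filter_eq_empty_iff] at h
      exact Finset.sum_eq_zero fun j hj => not_not.mp (h hj)
    rw [this, Nat.multichoose_zero_right, Nat.multichoose_zero_right]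
  · rfl

/-- The exponents of a polynomial ring with variables arranged in blocks. -/
def blockExpEquiv (α : ι → Type*) [∀ j, Fintype (α j)] :
    (∀ j, α j → ℕ) ≃ ((Σ j, α j) →₀ ℕ) :=
  (Equiv.piCurry fun (j : ι) (_ : α j) => ℕ).symm.trans Finsupp.equivFunOnFinite.symm

theorem weight_blockExpEquiv (e : ∀ j, α j → ℕ) :
    Finsupp.weight (blockWeight α) (blockExpEquiv α e) = fun j => ∑ k, e j k := by
  ext j
  rw [weight_blockWeight_apply, Finsupp.sum_fintype _ _ fun _ => rfl]
  rfl

theorem mem_expsOfDegree_iff {a : ι → ℕ} {e : ∀ j, α j → ℕ} :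
    e ∈ expsOfDegree a ↔ Finsupp.weight (blockWeight α) (blockExpEquiv α e) = a := by
  rw [weight_blockExpEquiv, expsOfDegree, Fintype.mem_piFinset, funext_iff]
  simp [Finset.mem_piAntidiag]

open Classical in
theorem card_filter_notMem_leadExps (τ : MonomialOrder (Σ j, α j)) (a : ι → ℕ) :
    ((expsOfDegree a).filter
      (· ∈ {e | blockExpEquiv α e ∉ leadExps τ (swapIdeal φ)})).card = (spanIndex φ a).card := by
  rw [← Finset.card_map (blockExpEquiv α).toEmbedding]
  refine card_eq_of_dual_of_span (blockWeight α) τ (swapIdeal φ)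
    (weightedHomogeneousComponent_mem_swapIdeal φ) a _ ?_ (spanIndex φ a)
    (fun x => spanElem φ (multisetOfCount x.1) x.2.1 (Finsupp.toMultiset x.2.2))
    (fun x => (lcoeff K x.2.2) ∘ₗ ((lcoeff (MvPolynomial ℕ K) x.2.1).restrictScalars K) ∘ₗ
      (evaluation φ (multisetOfCount x.1).toFinset).toLinearMap) ?_ ?_ ?_ ?_ ?_
  · intro d
    rw [Finset.mem_map_equiv, Finset.mem_filter, mem_expsOfDegree_iff, Set.mem_ofPred_eq,
      Equiv.apply_symm_apply]
  · rintro ⟨b, m, e⟩ hx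
    obtain ⟨-, ha, hcard, -⟩ := (mem_spanIndex φ).mp hx
    have h := isWeightedHomogeneous_spanElem φ m hcard
    simp only [count_multisetOfCount] at h
    rwa [← ha]
  · rintro ⟨b, m, e⟩ - f hf
    change coeff e (coeff m (evaluation φ _ f)) = 0
    rw [evaluation_eq_zero φ _ hf, coeff_zero, coeff_zero]
  · rintro ⟨b, m, e⟩ hx
    obtain ⟨hm, -, hcard, hL⟩ := (mem_spanIndex φ).mp hx
    change coeff e (coeff m (evaluation φ _ (spanElem φ _ _ _))) = 1
    rw [evaluation_spanElem φ hcard hm hL, coeff_monomial, if_pos rfl,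
      Finsupp.toMultiset_toFinsupp, coeff_monomial, if_pos rfl]
  · rintro ⟨b, m, e⟩ hx ⟨b', m', e'⟩ hy hne
    obtain ⟨-, ha, -, -⟩ := (mem_spanIndex φ).mp hx
    obtain ⟨hm, ha', hcard, hL⟩ := (mem_spanIndex φ).mp hy
    change coeff e (coeff m (evaluation φ _ (spanElem φ _ _ _))) = 0
    by_cases hmm : m' = m
    · subst hmm
      have hb : b' = b := add_right_cancel (ha'.trans ha.symm)
      subst hb
      rw [evaluation_spanElem φ hcard hm hL, coeff_monomial, if_pos rfl,
        Finsupp.toMultiset_toFinsupp, coeff_monomial, if_neg]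
      rintro rfl
      exact hne rfl
    · rw [coeff_evaluation_spanElem_of_ne φ _ hm hmm, coeff_zero]
  · rintro d rfl
    refine Submodule.span_mono ?_ (mk_monomial_mem_span φ d)
    rintro _ ⟨J, m, L, hJL, hm, hL, ha, rfl⟩
    refine ⟨⟨fun j => J.count j, m, Multiset.toFinsupp L⟩, ?_, ?_⟩
    · rw [Finset.mem_coe, mem_spanIndex, multisetOfCount_count, Multiset.toFinsupp_toMultiset]
      exact ⟨hm, ha, hJL, hL⟩
    · dsimp only
      rw [multisetOfCount_count, Multiset.toFinsupp_toMultiset]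

theorem nsmul_notMem_leadExps_swapIdeal (τ : MonomialOrder (Σ j, α j)) (d : (Σ j, α j) →₀ ℕ)
    (hd : d ∉ leadExps τ (swapIdeal φ)) (k : ℕ) : k • d ∉ leadExps τ (swapIdeal φ) := by
  classical
  have h := nsmul_mem_of_card_eq {e | blockExpEquiv α e ∉ leadExps τ (swapIdeal φ)}
    (fun e e' hle he h => he (isUpperSet_leadExps τ (swapIdeal φ)
      (show blockExpEquiv α e' ≤ blockExpEquiv α e from fun z => hle z.1 z.2) h))
    (fun j => (cokerBasis φ j).dim)
    (fun s => if s = ∅ then 1 else (quotBasis φ s).dim) (if_pos rfl)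
    (fun a => by rw [← card_spanIndex]; convert card_filter_notMem_leadExps φ τ a)
    ((blockExpEquiv α).symm d) (by simpa using hd) k
  have h2 : blockExpEquiv α (k • (blockExpEquiv α).symm d) = k • d := by
    ext z
    rfl
  rw [Set.mem_ofPred_eq, h2] at h
  exact h

end Counting

section Forms

variable {K ι : Type*} [Field K] [Fintype ι] [DecidableEq ι] {α : ι → Type*} [∀ j, Fintype (α j)]
  [∀ j, DecidableEq (α j)]

theorem exists_eq_single_of_weight_eq {j : ι} {d : (Σ j, α j) →₀ ℕ}
    (hd : Finsupp.weight (blockWeight α) d = Pi.single j 1) :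
    ∃ k, d = Finsupp.single ⟨j, k⟩ 1 := by
  have h : ∃ z, d z ≠ 0 := by
    by_contra! h
    have h0 : d = 0 := Finsupp.ext h
    rw [h0, map_zero] at hd
    simpa using congrFun hd j
  obtain ⟨⟨i, k⟩, hz⟩ := h
  have hle : Finsupp.single (⟨i, k⟩ : Σ j, α j) 1 ≤ d := by
    rw [Finsupp.single_le_iff]
    omega
  obtain ⟨d', rfl⟩ := exists_add_of_le hle
  rw [map_add, Finsupp.weight_single, one_smul] at hd
  have hij : i = j := by
    by_contra hij
    have := congrFun hd i
    simp [blockWeight, hij] at this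
  subst hij
  have h0 : Finsupp.weight (blockWeight α) d' = 0 := add_eq_left.mp hd
  refine ⟨k, ?_⟩
  have h1 : d' = 0 := by
    ext ⟨i', k'⟩
    have := congrFun h0 i'
    rw [weight_blockWeight_apply, Finsupp.sum_fintype _ _ fun _ => rfl] at this
    exact Finset.sum_eq_zero_iff.mp this k' (Finset.mem_univ _)
  rw [h1, add_zero]

theorem exists_eq_blockForm {j : ι} {f : MvPolynomial (Σ j, α j) K}
    (hf : f.IsWeightedHomogeneous (blockWeight α) (Pi.single j 1)) :
    ∃ u, f = blockForm K α j u := by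
  suffices h : f ∈ LinearMap.range (blockForm K α j) by
    obtain ⟨u, hu⟩ := h
    exact ⟨u, hu.symm⟩
  rw [MvPolynomial.as_sum f]
  refine Submodule.sum_mem _ fun d hd => ?_
  obtain ⟨k, hk⟩ := exists_eq_single_of_weight_eq (hf (mem_support_iff.mp hd))
  refine ⟨coeff d f • Pi.single k 1, ?_⟩
  rw [map_smul, blockForm_single, hk, X, smul_monomial, smul_eq_mul, mul_one]

end Forms

theorem exists_monomialOrder.{u} (σ : Type u) [Finite σ] :
    Nonempty (MonomialOrder.{u, u} σ) := by
  obtain ⟨k, ⟨e⟩⟩ := Finite.exists_equiv_fin σ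
  let _ : LinearOrder σ := LinearOrder.lift' e e.injective
  exact ⟨MonomialOrder.lex⟩

section Minors

variable {K : Type} [Field K] {v : ℕ} {n : Fin v → ℕ} {m N : ℕ}

theorem minorsIdeal_transpose {R : Type} [CommRing R] (t : ℕ) (A : Matrix (Fin m) (Fin N) R) :
    minorsIdeal t A.transpose = minorsIdeal t A := by
  rw [minorsIdeal, minorsIdeal]
  congr 1
  ext d
  constructor
  · rintro ⟨r, c, hr, hc, rfl⟩
    exact ⟨c, r, hc, hr, by rw [← Matrix.det_transpose, Matrix.transpose_submatrix,
      Matrix.transpose_transpose]⟩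
  · rintro ⟨r, c, hr, hc, rfl⟩
    exact ⟨c, r, hc, hr, by rw [← Matrix.det_transpose, Matrix.transpose_submatrix]⟩

theorem mul_sub_mul_mem_minorsIdeal {R : Type} [CommRing R] (A : Matrix (Fin m) (Fin N) R)
    (i i' : Fin m) (j j' : Fin N) : A i j * A i' j' - A i j' * A i' j ∈ minorsIdeal 2 A := by
  by_cases hi : i = i'
  · subst hi
    rw [mul_comm, sub_self]
    exact Ideal.zero_mem _
  by_cases hj : j = j'
  · subst hj
    rw [sub_self]
    exact Ideal.zero_mem _
  refine Ideal.subset_span ⟨![i, i'], ![j, j'], ?_, ?_, ?_⟩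
  · intro a b
    fin_cases a <;> fin_cases b <;> simp [hi, Ne.symm hi]
  · intro a b
    fin_cases a <;> fin_cases b <;> simp [hj, Ne.symm hj]
  · rw [Matrix.det_fin_two]
    rfl

theorem exists_minorsIdeal_eq_swapIdeal
    (A : Matrix (Fin m) (Fin N) (MvPolynomial (MVar v n) K)) (hA : ColumnGraded A) :
    ∃ φ : ∀ j : Fin v, (Fin m → K) →ₗ[K] (Fin (n j + 1) → K),
      minorsIdeal 2 A = swapIdeal φ := by
  obtain ⟨hN, hA⟩ := hA
  have hc : ∀ (i : Fin m) (j : Fin v), ∃ u : Fin (n j + 1) → K,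
      (if h : (j : ℕ) < N then A i ⟨j, h⟩ else 0) =
        blockForm K (fun j => Fin (n j + 1)) j u := by
    intro i j
    split_ifs with h
    · rcases hA i ⟨j, h⟩ with h0 | h1
      · exact ⟨0, by rw [h0, map_zero]⟩
      · exact exists_eq_blockForm h1
    · exact ⟨0, by rw [map_zero]⟩
  choose c hc using hc
  let φ : ∀ j : Fin v, (Fin m → K) →ₗ[K] (Fin (n j + 1) → K) :=
    fun j => Fintype.linearCombination K fun i => c i j
  have hφ : ∀ j u, blockMap φ j u =
      ∑ i, u i • blockForm K (fun j => Fin (n j + 1)) j (c i j) := by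
    intro j u
    rw [blockMap, LinearMap.comp_apply, Fintype.linearCombination_apply, map_sum]
    simp only [map_smul]
  have hφ1 : ∀ (i : Fin m) (j : Fin N), blockMap φ (Fin.castLE hN j) (Pi.single i 1) = A i j := by
    intro i j
    rw [hφ, Finset.sum_eq_single i]
    · rw [Pi.single_eq_same, one_smul, ← hc, dif_pos (by simp)]
      rfl
    · intro i' _ hne
      rw [Pi.single_eq_of_ne hne, zero_smul]
    · simp
  refine ⟨φ, le_antisymm (Ideal.span_le.mpr ?_) (Ideal.span_le.mpr ?_)⟩
  · rintro _ ⟨r, c, -, -, rfl⟩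
    refine Ideal.subset_span ⟨Fin.castLE hN (c 0), Fin.castLE hN (c 1), Pi.single (r 0) 1,
      Pi.single (r 1) 1, ?_⟩
    simp only [hφ1, Matrix.det_fin_two, Matrix.submatrix_apply]
  · rintro _ ⟨j, j', u, u', rfl⟩
    have h : blockMap φ j u * blockMap φ j' u' - blockMap φ j' u * blockMap φ j u' =
        ∑ i, ∑ i', (C (u i) * C (u' i')) *
          (blockForm K (fun j => Fin (n j + 1)) j (c i j) *
              blockForm K (fun j => Fin (n j + 1)) j' (c i' j') -
            blockForm K (fun j => Fin (n j + 1)) j' (c i j') *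
              blockForm K (fun j => Fin (n j + 1)) j (c i' j)) := by
      simp only [hφ, Finset.sum_mul_sum, smul_eq_C_mul, ← Finset.sum_sub_distrib]
      refine Finset.sum_congr rfl fun i _ => Finset.sum_congr rfl fun i' _ => ?_
      ring
    rw [h]
    refine Ideal.sum_mem _ fun i _ => Ideal.sum_mem _ fun i' _ => Ideal.mul_mem_left _ _ ?_
    rw [← hc, ← hc, ← hc, ← hc]
    split_ifs
    · exact mul_sub_mul_mem_minorsIdeal A i i' _ _
    all_goals simp

theorem isRadical_minorsIdeal_of_columnGraded
    (A : Matrix (Fin m) (Fin N) (MvPolynomial (MVar v n) K)) (hA : ColumnGraded A) :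
    (minorsIdeal 2 A).IsRadical ∧
      ∀ τ : MonomialOrder (MVar v n), (inIdeal τ (minorsIdeal 2 A)).IsRadical := by
  obtain ⟨φ, hφ⟩ := exists_minorsIdeal_eq_swapIdeal A hA
  rw [hφ]
  refine ⟨?_, fun τ => ?_⟩
  · obtain ⟨τ⟩ := exists_monomialOrder (MVar v n)
    exact isRadical_of_nsmul_notMem τ _ (nsmul_notMem_leadExps_swapIdeal φ τ)
  · convert isRadical_span_leadExps_of_nsmul_notMem τ _ (nsmul_notMem_leadExps_swapIdeal φ τ)
    rw [inIdeal]
    congr 1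
    ext g
    constructor
    · rintro ⟨f, hf, hf0, rfl⟩
      exact ⟨leadExp τ f, ⟨f, hf, hf0, rfl⟩, rfl⟩
    · rintro ⟨_, ⟨f, hf, hf0, rfl⟩, rfl⟩
      exact ⟨f, hf, hf0, rfl⟩

end Minors

/-- **Main Theorem (3).** If `A` is a column-graded or row-graded `m × n` matrix of linear
forms with `m ≤ n`, then the ideal `I_2(A)` of `2`-minors is radical and every initial
ideal of `I_2(A)` is radical. -/
theorem two_minors_radical
    {K : Type} [Field K] [Infinite K] {v : ℕ} {n : Fin v → ℕ} {m N : ℕ} (hmn : m ≤ N)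
    (A : Matrix (Fin m) (Fin N) (MvPolynomial (MVar v n) K))
    (hA : ColumnGraded A ∨ RowGraded A) :
    (minorsIdeal 2 A).IsRadical ∧
    ∀ τ : MonomialOrder (MVar v n), (inIdeal τ (minorsIdeal 2 A)).IsRadical := by
  rcases hA with hA | ⟨h, hA⟩
  · exact isRadical_minorsIdeal_of_columnGraded A hA
  · rw [← minorsIdeal_transpose]
    exact isRadical_minorsIdeal_of_columnGraded A.transpose ⟨h, fun i j => hA j i⟩

end
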